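/- arXiv:1309.7440 — 12 statements merged into one kernel-verified Lean document; each statement's English description precedes it below -/
import Mathlib

section
/- If a finite simple graph G is everywhere ε-triangle dense for some ε ∈ (0,1] (i.e., every edge has Jaccard similarity at least ε and G has no isolated vertices), then G is ε-triangle dense: 3·t(G) ≥ ε·w(G). -/
open scoped Classical
open Finset

/-- Number of triangles of a finite simple graph. -/
noncomputable def tcount {V : Type*} [Fintype V] [DecidableEq V] (G : SimpleGraph V) : ℕ :=
  (G.cliqueFinset 3).card

/-- Number of wedges (paths of length two) of a finite simple graph. -/
noncomputable def wcount {V : Type*} [Fintype V] [DecidableEq V] (G : SimpleGraph V) : ℕ :=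
  ∑ v, (G.degree v).choose 2

/-- Jaccard similarity `J_e = |N(i) ∩ N(j)| / |N(i) ∪ N(j) \ {i,j}|` of an edge `{i,j}`. -/
noncomputable def jac {V : Type*} [Fintype V] [DecidableEq V] (G : SimpleGraph V)
    (i j : V) : ℝ :=
  ((G.neighborFinset i ∩ G.neighborFinset j).card : ℝ) /
    (((G.neighborFinset i ∪ G.neighborFinset j) \ {i, j}).card : ℝ)

/-- Ordered triangles number at most six per triangle. -/
theorem ordered_triangles_le {V : Type*} [Fintype V] [DecidableEq V] (G : SimpleGraph V) :
    (univ.filter (fun p : V × V × V => G.Adj p.1 p.2.1 ∧ G.Adj p.1 p.2.2 ∧ G.Adj p.2.1 p.2.2)).card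
      ≤ 6 * tcount G := by
  unfold tcount
  refine Finset.card_le_mul_card_image_of_maps_to
    (f := fun p : V × V × V => ({p.1, p.2.1, p.2.2} : Finset V)) ?_ 6 ?_
  · rintro ⟨a, b, c⟩ h
    simp only [mem_filter, mem_univ, true_and] at h
    rw [SimpleGraph.mem_cliqueFinset_iff, SimpleGraph.is3Clique_iff]
    exact ⟨a, b, c, h.1, h.2.1, h.2.2, rfl⟩
  · intro s hs
    rw [SimpleGraph.mem_cliqueFinset_iff, SimpleGraph.is3Clique_iff] at hs
    obtain ⟨a, b, c, hab, hac, hbc, rfl⟩ := hs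
    refine le_trans (Finset.card_le_card (t :=
      {(a, b, c), (a, c, b), (b, a, c), (b, c, a), (c, a, b), (c, b, a)}) ?_) Finset.card_le_six
    rintro ⟨x, y, z⟩ h
    simp only [mem_filter, mem_univ, true_and] at h
    obtain ⟨⟨h1, h2, h3⟩, h4⟩ := h
    have hx : x ∈ ({a, b, c} : Finset V) := by rw [← h4]; simp
    have hy : y ∈ ({a, b, c} : Finset V) := by rw [← h4]; simp
    have hz : z ∈ ({a, b, c} : Finset V) := by rw [← h4]; simp
    have n1 := h1.ne
    have n2 := h2.ne
    have n3 := h3.ne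
    clear h4 h1 h2 h3
    simp only [mem_insert, mem_singleton, Prod.mk.injEq] at hx hy hz ⊢
    rcases hx with rfl | rfl | rfl <;> rcases hy with rfl | rfl | rfl <;>
      rcases hz with rfl | rfl | rfl <;> simp_all

theorem ordered_triangles_eq {V : Type*} [Fintype V] [DecidableEq V] (G : SimpleGraph V) :
    (univ.filter (fun p : V × V × V => G.Adj p.1 p.2.1 ∧ G.Adj p.1 p.2.2 ∧ G.Adj p.2.1 p.2.2)).card
      = ∑ i, ∑ j ∈ G.neighborFinset i, (G.neighborFinset i ∩ G.neighborFinset j).card := by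
  rw [Finset.card_filter, Fintype.sum_prod_type]
  refine Finset.sum_congr rfl fun i _ => ?_
  rw [Fintype.sum_prod_type, ← Finset.sum_subset (Finset.subset_univ (G.neighborFinset i))]
  · refine Finset.sum_congr rfl fun j hj => ?_
    rw [← Finset.card_filter]
    congr 1
    ext k
    rw [SimpleGraph.mem_neighborFinset] at hj
    simp [hj]
  · intro j _ hj
    rw [SimpleGraph.mem_neighborFinset] at hj
    simp [hj]

theorem edge_bound {V : Type*} [Fintype V] [DecidableEq V]
    (G : SimpleGraph V) (ε : ℝ) (hε0 : 0 < ε) (i j : V) (h : G.Adj i j) (hJ : ε ≤ jac G i j) :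
    ε * ((G.degree i : ℝ) - 1) ≤ ((G.neighborFinset i ∩ G.neighborFinset j).card : ℝ) := by
  unfold jac at hJ
  set U := (G.neighborFinset i ∪ G.neighborFinset j) \ {i, j} with hU
  have hpos : (0 : ℝ) < (U.card : ℝ) := by
    rcases (Nat.cast_nonneg (α := ℝ) U.card).eq_or_lt with h0 | h0
    · rw [← h0, div_zero] at hJ
      linarith
    · exact h0
  rw [le_div_iff₀ hpos] at hJ
  refine le_trans (mul_le_mul_of_nonneg_left ?_ hε0.le) hJ
  have hsub : (G.neighborFinset i).erase j ⊆ U := by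
    intro k hk
    rw [mem_erase, SimpleGraph.mem_neighborFinset] at hk
    have := hk.2.ne'
    simp [hU, hk.1, hk.2, this]
  have hc := Finset.card_le_card hsub
  have he := Finset.card_erase_add_one ((SimpleGraph.mem_neighborFinset G i j).2 h)
  rw [SimpleGraph.card_neighborFinset_eq_degree] at he
  have : G.degree i ≤ U.card + 1 := by omega
  have : (G.degree i : ℝ) ≤ U.card + 1 := by exact_mod_cast this
  linarith

theorem everywhere_dense_implies_dense {V : Type*} [Fintype V] [DecidableEq V]
    (G : SimpleGraph V) (ε : ℝ) (hε0 : 0 < ε) (hε1 : ε ≤ 1)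
    (hJ : ∀ i j, G.Adj i j → ε ≤ jac G i j)
    (hiso : ∀ v, 0 < G.degree v) :
    ε * (wcount G : ℝ) ≤ 3 * (tcount G : ℝ) := by
  have h1 := ordered_triangles_le G
  rw [ordered_triangles_eq] at h1
  have h2 : ((∑ i, ∑ j ∈ G.neighborFinset i,
      (G.neighborFinset i ∩ G.neighborFinset j).card : ℕ) : ℝ) ≤ 6 * (tcount G : ℝ) := by
    exact_mod_cast h1
  have h3 : 2 * (ε * (wcount G : ℝ)) ≤ ((∑ i, ∑ j ∈ G.neighborFinset i,
      (G.neighborFinset i ∩ G.neighborFinset j).card : ℕ) : ℝ) := by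
    unfold wcount
    push_cast
    rw [Finset.mul_sum, Finset.mul_sum]
    refine Finset.sum_le_sum fun i _ => ?_
    have h4 := Finset.card_nsmul_le_sum (G.neighborFinset i)
      (fun j => ((G.neighborFinset i ∩ G.neighborFinset j).card : ℝ))
      (ε * ((G.degree i : ℝ) - 1)) (fun j hj => by
        rw [SimpleGraph.mem_neighborFinset] at hj
        exact edge_bound G ε hε0 i j hj (hJ i j hj))
    rw [SimpleGraph.card_neighborFinset_eq_degree, nsmul_eq_mul] at h4
    rw [Nat.cast_choose_two]
    linarith
  linarith
end

section
/- (Claim on cleaning) Let H be a finite simple graph, ε ∈ (0,1], and let H = G_0, G_1, …, G_m be a sequence of graphs on the same vertex set where each G_l is obtained from G_{l−1} by deleting a single edge e_l of G_{l−1} whose Jaccard similarity in G_{l−1} is less than ε. Then t(G_m) ≥ t(H) − ε·w(H), i.e., the total number of triangles destroyed over the whole process is at most ε times the number of wedges of H. -/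
open scoped Classical
open Finset

theorem tcount_step {V : Type*} [Fintype V] [DecidableEq V] (G G' : SimpleGraph V) (i j : V)
    (hG : G' = G.deleteEdges {s(i, j)}) :
    tcount G ≤ tcount G' +
      (G.neighborFinset i ∩ G.neighborFinset j).card := by
  have hsub : G.cliqueFinset 3 ⊆ G'.cliqueFinset 3 ∪
      (G.neighborFinset i ∩ G.neighborFinset j).image (fun k => ({i, j, k} : Finset V)) := by
    intro T hT
    rw [SimpleGraph.mem_cliqueFinset_iff, SimpleGraph.is3Clique_iff] at hT
    obtain ⟨a, b, c, hab, hac, hbc, rfl⟩ := hT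
    rw [Finset.mem_union]
    by_cases h1 : s(a, b) = s(i, j)
    · right
      rw [Finset.mem_image]
      refine ⟨c, ?_, ?_⟩
      · rw [Sym2.eq_iff] at h1
        rcases h1 with ⟨rfl, rfl⟩ | ⟨rfl, rfl⟩ <;> simp [hac, hbc]
      · rw [Sym2.eq_iff] at h1
        rcases h1 with ⟨rfl, rfl⟩ | ⟨rfl, rfl⟩ <;> grind
    by_cases h2 : s(a, c) = s(i, j)
    · right
      rw [Finset.mem_image]
      refine ⟨b, ?_, ?_⟩
      · rw [Sym2.eq_iff] at h2
        rcases h2 with ⟨rfl, rfl⟩ | ⟨rfl, rfl⟩ <;> simp [hab, hbc.symm]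
      · rw [Sym2.eq_iff] at h2
        rcases h2 with ⟨rfl, rfl⟩ | ⟨rfl, rfl⟩ <;> grind
    by_cases h3 : s(b, c) = s(i, j)
    · right
      rw [Finset.mem_image]
      refine ⟨a, ?_, ?_⟩
      · rw [Sym2.eq_iff] at h3
        rcases h3 with ⟨rfl, rfl⟩ | ⟨rfl, rfl⟩ <;> simp [hab.symm, hac.symm]
      · rw [Sym2.eq_iff] at h3
        rcases h3 with ⟨rfl, rfl⟩ | ⟨rfl, rfl⟩ <;> grind
    left
    rw [SimpleGraph.mem_cliqueFinset_iff, SimpleGraph.is3Clique_iff]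
    refine ⟨a, b, c, ?_, ?_, ?_, rfl⟩ <;> rw [hG, SimpleGraph.deleteEdges_adj] <;>
      simp only [Set.mem_singleton_iff] <;> constructor <;> assumption
  unfold tcount
  exact (Finset.card_le_card hsub).trans
    ((Finset.card_union_le _ _).trans (Nat.add_le_add_left Finset.card_image_le _))

theorem choose_step (a b : ℕ) (h : a + 1 ≤ b) : a.choose 2 + (b - 1) ≤ b.choose 2 := by
  obtain ⟨c, rfl⟩ : ∃ c, b = c + 1 := ⟨b - 1, by omega⟩
  have h1 : (c + 1).choose 2 = c.choose 1 + c.choose 2 := Nat.choose_succ_succ c 1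
  have h2 : a.choose 2 ≤ c.choose 2 := Nat.choose_le_choose 2 (by omega)
  rw [Nat.choose_one_right] at h1
  omega

theorem degree_step {V : Type*} [Fintype V] [DecidableEq V] (G G' : SimpleGraph V) (i j : V)
    (hG : G' = G.deleteEdges {s(i, j)})
    (hij : G.Adj i j) : G'.degree i + 1 ≤ G.degree i := by
  rw [← SimpleGraph.card_neighborFinset_eq_degree, ← SimpleGraph.card_neighborFinset_eq_degree,
    Nat.succ_le_iff]
  apply Finset.card_lt_card
  rw [Finset.ssubset_iff_of_subset]
  · exact ⟨j, by simpa using hij, by simp [hG]⟩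
  · intro x hx
    simp only [hG, SimpleGraph.mem_neighborFinset, SimpleGraph.deleteEdges_adj] at hx ⊢
    exact hx.1

theorem wcount_step {V : Type*} [Fintype V] [DecidableEq V] (G G' : SimpleGraph V) (i j : V)
    (hG : G' = G.deleteEdges {s(i, j)})
    (hij : G.Adj i j) :
    wcount G' + ((G.degree i - 1) + (G.degree j - 1)) ≤ wcount G := by
  have hi := choose_step _ _ (degree_step G G' i j hG hij)
  have hj := choose_step _ _ (degree_step G G' j i (by rw [hG, Sym2.eq_swap]) hij.symm)
  have hne := hij.ne
  have key : ∀ v, (G'.degree v).choose 2 +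
      ((if v = i then G.degree i - 1 else 0) + (if v = j then G.degree j - 1 else 0))
      ≤ (G.degree v).choose 2 := by
    intro v
    by_cases h1 : v = i
    · subst h1
      simpa [hne] using hi
    by_cases h2 : v = j
    · subst h2
      simpa [h1] using hj
    simp only [h1, h2, if_false, add_zero]
    exact Nat.choose_le_choose 2 (SimpleGraph.degree_le_of_le (hG ▸ SimpleGraph.deleteEdges_le _))
  have := Finset.sum_le_sum (fun v (_ : v ∈ (Finset.univ : Finset V)) => key v)
  simpa [Finset.sum_add_distrib, wcount] using this

theorem union_step {V : Type*} [Fintype V] [DecidableEq V] (G : SimpleGraph V) (i j : V)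
    (hij : G.Adj i j) :
    ((G.neighborFinset i ∪ G.neighborFinset j) \ {i, j}).card ≤
      (G.degree i - 1) + (G.degree j - 1) := by
  have hsub : (G.neighborFinset i ∪ G.neighborFinset j) \ {i, j} ⊆
      (G.neighborFinset i).erase j ∪ (G.neighborFinset j).erase i := by
    intro x hx
    simp only [Finset.mem_sdiff, Finset.mem_union, Finset.mem_insert, Finset.mem_singleton,
      Finset.mem_erase] at hx ⊢
    tauto
  refine (Finset.card_le_card hsub).trans ((Finset.card_union_le _ _).trans ?_)
  rw [Finset.card_erase_of_mem (by simpa using hij),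
    Finset.card_erase_of_mem (by simpa using hij.symm)]
  simp

theorem inter_step {V : Type*} [Fintype V] [DecidableEq V] (G : SimpleGraph V) (i j : V)
    (ε : ℝ) (h : jac G i j < ε) :
    ((G.neighborFinset i ∩ G.neighborFinset j).card : ℝ) ≤
      ε * (((G.neighborFinset i ∪ G.neighborFinset j) \ {i, j}).card : ℝ) := by
  have hsub : G.neighborFinset i ∩ G.neighborFinset j ⊆
      (G.neighborFinset i ∪ G.neighborFinset j) \ {i, j} := by
    intro x hx
    simp only [Finset.mem_sdiff, Finset.mem_union, Finset.mem_insert, Finset.mem_singleton,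
      Finset.mem_inter, SimpleGraph.mem_neighborFinset] at hx ⊢
    refine ⟨Or.inl hx.1, ?_⟩
    rintro (rfl | rfl)
    · exact hx.1.ne rfl
    · exact hx.2.ne rfl
  have hc := Finset.card_le_card hsub
  unfold jac at h
  rcases Nat.eq_zero_or_pos ((G.neighborFinset i ∪ G.neighborFinset j) \ {i, j}).card with h0 | h0
  · rw [h0] at hc ⊢
    rw [Nat.le_zero.mp hc]
    simp
  · rw [div_lt_iff₀ (by exact_mod_cast h0)] at h
    exact h.le

/-- Cleaning claim: iteratively deleting edges whose current Jaccard similarity is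
less than `ε` destroys at most `ε · w(H)` triangles. -/
theorem cleaning_destroys_few_triangles {V : Type*} [Fintype V] [DecidableEq V]
    (H : SimpleGraph V) (ε : ℝ) (hε0 : 0 < ε) (hε1 : ε ≤ 1)
    (m : ℕ) (Gs : ℕ → SimpleGraph V) (h0 : Gs 0 = H)
    (hstep : ∀ l < m, ∃ i j, (Gs l).Adj i j ∧ jac (Gs l) i j < ε ∧
      Gs (l + 1) = (Gs l).deleteEdges {s(i, j)}) :
    (tcount H : ℝ) - ε * (wcount H : ℝ) ≤ (tcount (Gs m) : ℝ) := by
  have main : ∀ l ≤ m, (tcount H : ℝ) - ε * (wcount H : ℝ) ≤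
      (tcount (Gs l) : ℝ) - ε * (wcount (Gs l) : ℝ) := by
    intro l
    induction l with
    | zero => intro _; rw [h0]
    | succ l ih =>
      intro hl
      have ih' := ih (by omega)
      obtain ⟨i, j, hij, hjac, hG⟩ := hstep l (by omega)
      have h1 := inter_step (Gs l) i j ε hjac
      have h2 := tcount_step (Gs l) _ i j hG
      have h3 := (Nat.add_le_add_left (union_step (Gs l) i j hij) _).trans
        (wcount_step (Gs l) _ i j hG hij)
      have h2' := (Nat.cast_le (α := ℝ)).mpr h2
      have h3' := mul_le_mul_of_nonneg_left ((Nat.cast_le (α := ℝ)).mpr h3) hε0.le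
      push_cast [mul_add] at h2' h3'
      linarith
  have hm := main m le_rfl
  have : 0 ≤ ε * (wcount (Gs m) : ℝ) := by positivity
  linarith
end

section
/- (Corollary on cleaning) Let H be a finite simple graph, ε ∈ (0,1], and let H = G_0, G_1, …, G_m be a sequence of graphs on the same vertex set where each G_l is obtained from G_{l−1} by deleting a single edge e_l of G_{l−1} whose Jaccard similarity in G_{l−1} is less than ε. If, in addition, every edge of G_m has Jaccard similarity at least ε in G_m, then the subgraph of G_m induced on its non-isolated vertices is everywhere ε-triangle dense and G_m has at least (τ(H)/3 − ε)·w(H) triangles. -/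
open scoped Classical
open Finset

/-- Triangle density `τ(G) = 3 t(G) / w(G)` (equal to `0` when `w(G) = 0`). -/
noncomputable def tau {V : Type*} [Fintype V] [DecidableEq V] (G : SimpleGraph V) : ℝ :=
  3 * (tcount G : ℝ) / (wcount G : ℝ)

theorem aux_tri {V : Type*} [Fintype V] [DecidableEq V] (G G' : SimpleGraph V) (i j : V)
    (hG : ∀ a b, G'.Adj a b ↔ G.Adj a b ∧ s(a, b) ≠ s(i, j)) :
    tcount G ≤ tcount G' +
      (G.neighborFinset i ∩ G.neighborFinset j).card := by
  unfold tcount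
  have hsub : G.cliqueFinset 3 ⊆ G'.cliqueFinset 3 ∪
      (G.neighborFinset i ∩ G.neighborFinset j).image (fun k => ({i, j, k} : Finset V)) := by
    intro s hs
    rw [SimpleGraph.mem_cliqueFinset_iff] at hs
    rw [Finset.mem_union]
    by_cases h : i ∈ s ∧ j ∈ s ∧ i ≠ j
    · right
      obtain ⟨hi, hj, hij⟩ := h
      have hc : ((s.erase i).erase j).card = 1 := by
        rw [Finset.card_erase_of_mem (Finset.mem_erase.2 ⟨hij.symm, hj⟩),
          Finset.card_erase_of_mem hi, hs.card_eq]
      obtain ⟨k, hk⟩ := Finset.card_eq_one.1 hc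
      have hk' : k ∈ (s.erase i).erase j := by rw [hk]; simp
      simp only [Finset.mem_erase] at hk'
      refine Finset.mem_image.2 ⟨k, ?_, ?_⟩
      · simp only [Finset.mem_inter, SimpleGraph.mem_neighborFinset]
        exact ⟨hs.isClique hi hk'.2.2 (Ne.symm hk'.2.1), hs.isClique hj hk'.2.2 (Ne.symm hk'.1)⟩
      · rw [← Finset.insert_erase hi, ← Finset.insert_erase (Finset.mem_erase.2 ⟨hij.symm, hj⟩), hk]
    · left
      rw [SimpleGraph.mem_cliqueFinset_iff]
      refine ⟨?_, hs.card_eq⟩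
      intro a ha b hb hab
      rw [hG]
      refine ⟨hs.isClique ha hb hab, ?_⟩
      intro he
      simp only [Sym2.eq_iff] at he
      rcases he with ⟨rfl, rfl⟩ | ⟨rfl, rfl⟩
      · exact h ⟨ha, hb, hab⟩
      · exact h ⟨hb, ha, hab.symm⟩
  exact (Finset.card_le_card hsub).trans ((Finset.card_union_le _ _).trans
    (Nat.add_le_add_left Finset.card_image_le _))

theorem aux_choose (d e : ℕ) (h : e + 1 ≤ d) : e.choose 2 + (d - 1) ≤ d.choose 2 := by
  obtain ⟨k, rfl⟩ : ∃ k, d = k + 1 := ⟨d - 1, by omega⟩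
  have h1 : e.choose 2 ≤ k.choose 2 := Nat.choose_le_choose 2 (by omega)
  have h2 := Nat.choose_succ_succ' k 1
  simp at h2 ⊢
  omega

theorem aux_deg {V : Type*} [Fintype V] [DecidableEq V] (G G' : SimpleGraph V) (i j : V)
    (hG : ∀ a b, G'.Adj a b ↔ G.Adj a b ∧ s(a, b) ≠ s(i, j))
    (h : G.Adj i j) : G'.degree i + 1 ≤ G.degree i := by
  rw [← SimpleGraph.card_neighborFinset_eq_degree, ← SimpleGraph.card_neighborFinset_eq_degree]
  have hj : j ∈ G.neighborFinset i := by simpa using h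
  rw [← Finset.card_erase_add_one hj]
  apply Nat.add_le_add_right
  apply Finset.card_le_card
  intro k hk
  simp only [SimpleGraph.mem_neighborFinset, hG, ne_eq,
    Finset.mem_erase] at hk ⊢
  exact ⟨by rintro rfl; exact hk.2 rfl, hk.1⟩

theorem aux_wedge {V : Type*} [Fintype V] [DecidableEq V] (G G' : SimpleGraph V) (i j : V)
    (hG : ∀ a b, G'.Adj a b ↔ G.Adj a b ∧ s(a, b) ≠ s(i, j))
    (h : G.Adj i j) :
    wcount G' +
      ((G.neighborFinset i ∪ G.neighborFinset j) \ {i, j}).card ≤ wcount G := by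
  have hu : ((G.neighborFinset i ∪ G.neighborFinset j) \ {i, j}).card ≤
      (G.degree i - 1) + (G.degree j - 1) := by
    have hj : j ∈ G.neighborFinset i := by simpa using h
    have hi : i ∈ G.neighborFinset j := by simpa using h.symm
    rw [← SimpleGraph.card_neighborFinset_eq_degree, ← SimpleGraph.card_neighborFinset_eq_degree,
      ← Finset.card_erase_of_mem hj, ← Finset.card_erase_of_mem hi]
    refine (Finset.card_le_card ?_).trans (Finset.card_union_le _ _)
    intro k hk
    simp only [Finset.mem_sdiff, Finset.mem_union, Finset.mem_insert, Finset.mem_singleton,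
      Finset.mem_erase] at hk ⊢
    tauto
  have hs : ∑ v, ((G'.degree v).choose 2 +
      ((if v = i then G.degree i - 1 else 0) + (if v = j then G.degree j - 1 else 0))) ≤
      ∑ v, (G.degree v).choose 2 := by
    apply Finset.sum_le_sum
    intro v _
    by_cases hi : v = i
    · subst hi
      have := aux_choose _ _ (aux_deg G G' v j hG h)
      simpa [h.ne] using this
    · by_cases hj : v = j
      · subst hj
        have h2 := aux_deg G G' v i (by simpa only [Sym2.eq_swap] using hG) h.symm
        have := aux_choose _ _ h2
        simpa [hi] using this
      · simp only [hi, hj, if_false, add_zero]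
        exact Nat.choose_le_choose 2 (SimpleGraph.degree_le_of_le (fun a b hab => ((hG a b).1 hab).1))
  rw [Finset.sum_add_distrib, Finset.sum_add_distrib] at hs
  simp only [Finset.sum_ite_eq', Finset.mem_univ, if_true] at hs
  unfold wcount
  omega

theorem aux_step {V : Type*} [Fintype V] [DecidableEq V] (G : SimpleGraph V) (ε : ℝ)
    (hε : 0 < ε) (i j : V) (h : G.Adj i j) (hJ : jac G i j < ε) :
    (tcount G : ℝ) - ε * wcount G ≤
      tcount (G.deleteEdges {s(i, j)}) - ε * wcount (G.deleteEdges {s(i, j)}) := by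
  have hG : ∀ a b, (G.deleteEdges {s(i, j)}).Adj a b ↔ G.Adj a b ∧ s(a, b) ≠ s(i, j) := by
    intro a b; rw [SimpleGraph.deleteEdges_adj]; simp only [Set.mem_singleton_iff, ne_eq]
  have h1 := aux_tri G _ i j hG
  have h2 := aux_wedge G _ i j hG h
  have h3 : ((G.neighborFinset i ∩ G.neighborFinset j).card : ℝ) ≤
      ε * ((G.neighborFinset i ∪ G.neighborFinset j) \ {i, j}).card := by
    have hsub : (G.neighborFinset i ∩ G.neighborFinset j).card ≤
        ((G.neighborFinset i ∪ G.neighborFinset j) \ {i, j}).card := by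
      apply Finset.card_le_card
      intro k hk
      simp only [Finset.mem_inter, SimpleGraph.mem_neighborFinset] at hk
      simp only [Finset.mem_sdiff, Finset.mem_union, Finset.mem_insert, Finset.mem_singleton,
        SimpleGraph.mem_neighborFinset]
      exact ⟨Or.inl hk.1, by
        rintro (rfl | rfl)
        · exact hk.1.ne rfl
        · exact hk.2.ne rfl⟩
    unfold jac at hJ
    rcases Nat.eq_zero_or_pos ((G.neighborFinset i ∪ G.neighborFinset j) \ {i, j}).card with h0 | h0
    · rw [h0] at hsub ⊢
      rw [Nat.le_zero.1 hsub]; simp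
    · have h0' : (0 : ℝ) < ((G.neighborFinset i ∪ G.neighborFinset j) \ {i, j}).card := by
        exact_mod_cast h0
      exact ((div_lt_iff₀ h0').1 hJ).le
  have h1' : (tcount G : ℝ) ≤ tcount (G.deleteEdges {s(i, j)}) +
      ((G.neighborFinset i ∩ G.neighborFinset j).card : ℝ) := by exact_mod_cast h1
  have h2' : (wcount (G.deleteEdges {s(i, j)}) : ℝ) +
      (((G.neighborFinset i ∪ G.neighborFinset j) \ {i, j}).card : ℝ) ≤ wcount G := by
    exact_mod_cast h2
  have := mul_le_mul_of_nonneg_left h2' hε.le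
  linarith

theorem aux_jac {V : Type*} [Fintype V] [DecidableEq V] (G : SimpleGraph V) (S : Set V)
    [Fintype S] [DecidableEq S] (hS : ∀ v u, G.Adj v u → u ∈ S) (a b : S) :
    jac (G.induce S) a b = jac G a b := by
  unfold jac
  congr 2
  · rw [← Finset.card_map (Function.Embedding.subtype (· ∈ S))]
    congr 1
    ext k
    simp only [Finset.mem_map, Finset.mem_inter, SimpleGraph.mem_neighborFinset,
      Function.Embedding.subtype_apply, SimpleGraph.comap_adj]
    constructor
    · rintro ⟨x, hx, rfl⟩; exact hx
    · intro hk; exact ⟨⟨k, hS _ _ hk.1⟩, hk, rfl⟩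
  · rw [← Finset.card_map (Function.Embedding.subtype (· ∈ S))]
    congr 1
    ext k
    simp only [Finset.mem_map, Finset.mem_sdiff, Finset.mem_union, Finset.mem_insert,
      Finset.mem_singleton, SimpleGraph.mem_neighborFinset,
      Function.Embedding.subtype_apply, SimpleGraph.comap_adj, Subtype.ext_iff]
    constructor
    · rintro ⟨x, hx, rfl⟩; exact hx
    · intro hk; exact ⟨⟨k, hk.1.elim (hS _ _) (hS _ _)⟩, hk, rfl⟩

/-- Cleaning corollary: if after iteratively deleting low-Jaccard edges every remaining
edge has Jaccard similarity at least `ε`, then the subgraph induced on the non-isolated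
vertices is everywhere `ε`-triangle dense, and at least `(τ(H)/3 − ε)·w(H)` triangles
remain. -/
theorem cleaned_graph_everywhere_dense {V : Type*} [Fintype V] [DecidableEq V]
    (H : SimpleGraph V) (ε : ℝ) (hε0 : 0 < ε) (hε1 : ε ≤ 1)
    (m : ℕ) (Gs : ℕ → SimpleGraph V) (h0 : Gs 0 = H)
    (hstep : ∀ l < m, ∃ i j, (Gs l).Adj i j ∧ jac (Gs l) i j < ε ∧
      Gs (l + 1) = (Gs l).deleteEdges {s(i, j)})
    (hfinal : ∀ i j, (Gs m).Adj i j → ε ≤ jac (Gs m) i j) :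
    ∀ S : Set V, S = {v | ∃ u, (Gs m).Adj v u} →
      ((∀ a b : S, ((Gs m).induce S).Adj a b → ε ≤ jac ((Gs m).induce S) a b) ∧
        (∀ a : S, 0 < ((Gs m).induce S).degree a)) ∧
      (tau H / 3 - ε) * (wcount H : ℝ) ≤ (tcount (Gs m) : ℝ) := by
  intro S hS
  have hmem : ∀ v u, (Gs m).Adj v u → u ∈ S := by
    intro v u h
    rw [hS]; exact ⟨v, h.symm⟩
  refine ⟨⟨?_, ?_⟩, ?_⟩
  · intro a b hab
    rw [aux_jac (Gs m) S hmem a b]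
    exact hfinal _ _ hab
  · intro a
    rw [SimpleGraph.degree_pos_iff_exists_adj]
    obtain ⟨u, hu⟩ : ∃ u, (Gs m).Adj a u := hS.subset a.2
    exact ⟨⟨u, hmem _ _ hu⟩, hu⟩
  · have key : ∀ l ≤ m, (tcount H : ℝ) - ε * wcount H ≤ tcount (Gs l) - ε * wcount (Gs l) := by
      intro l
      induction l with
      | zero => intro _; rw [h0]
      | succ l ih =>
        intro hl
        obtain ⟨i, j, hadj, hJ, he⟩ := hstep l (by omega)
        rw [he]
        exact (ih (by omega)).trans (aux_step (Gs l) ε hε0 i j hadj hJ)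
    have hk := key m le_rfl
    have hw : 0 ≤ ε * (wcount (Gs m) : ℝ) := by positivity
    rcases Nat.eq_zero_or_pos (wcount H) with hz | hz
    · rw [hz]; simp
    · have hz' : (wcount H : ℝ) ≠ 0 := by exact_mod_cast hz.ne'
      have : (tau H / 3 - ε) * (wcount H : ℝ) = tcount H - ε * wcount H := by
        unfold tau; field_simp
      rw [this]; linarith
end

section
/- (Balance lemma) Let H be an everywhere ε-triangle dense finite simple graph with ε ∈ (0,1]. Then (1) for every edge {i,j} of H, the degrees satisfy d_i ≥ ε·d_j; and (2) for every vertex i, the subgraph of H induced on the neighborhood N(i) has at least ε·C(d_i, 2) edges, i.e., N(i) is ε-edge dense. -/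
open scoped Classical
open Finset

/-- Number of edges of a finite simple graph. -/
noncomputable def ecount {V : Type*} [Fintype V] [DecidableEq V] (G : SimpleGraph V) : ℕ :=
  G.edgeFinset.card

/-- The common neighborhood of the ends of an edge is large. -/
lemma common_ge {V : Type*} [Fintype V] [DecidableEq V]
    (H : SimpleGraph V) (ε : ℝ) (hε0 : 0 < ε)
    (hJ : ∀ i j, H.Adj i j → ε ≤ jac H i j) (i j : V) (h : H.Adj i j) :
    ε * ((H.degree j : ℝ) - 1) ≤ ((H.neighborFinset i ∩ H.neighborFinset j).card : ℝ) := by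
  have h1 := hJ i j h
  unfold jac at h1
  have h2 : (H.neighborFinset j).erase i ⊆
      (H.neighborFinset i ∪ H.neighborFinset j) \ {i, j} := by
    intro x hx
    simp only [Finset.mem_erase, SimpleGraph.mem_neighborFinset] at hx
    have := hx.2.ne'
    simp [hx.1, hx.2, this]
  have h3 := Finset.card_le_card h2
  rw [Finset.card_erase_of_mem (by simpa using h.symm), SimpleGraph.card_neighborFinset_eq_degree]
    at h3
  have h4 : (H.degree j : ℝ) - 1 ≤
      (((H.neighborFinset i ∪ H.neighborFinset j) \ {i, j}).card : ℝ) := by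
    have : H.degree j ≤ ((H.neighborFinset i ∪ H.neighborFinset j) \ {i, j}).card + 1 := by omega
    have : (H.degree j : ℝ) ≤
      (((H.neighborFinset i ∪ H.neighborFinset j) \ {i, j}).card : ℝ) + 1 := by exact_mod_cast this
    linarith
  refine (mul_le_mul_of_nonneg_left h4 hε0.le).trans ?_
  rcases (Nat.cast_nonneg (α := ℝ)
    ((H.neighborFinset i ∪ H.neighborFinset j) \ {i, j}).card).eq_or_lt with h5 | h5
  · rw [← h5]; simp
  · exact (le_div_iff₀ h5).1 h1

/-- Balance lemma: in an everywhere `ε`-triangle dense graph, degrees of adjacent vertices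
are within a factor of `ε` of each other, and every vertex neighborhood is `ε`-edge dense. -/
theorem balance_lemma {V : Type*} [Fintype V] [DecidableEq V]
    (H : SimpleGraph V) (ε : ℝ) (hε0 : 0 < ε) (hε1 : ε ≤ 1)
    (hJ : ∀ i j, H.Adj i j → ε ≤ jac H i j)
    (hiso : ∀ v, 0 < H.degree v) :
    (∀ i j, H.Adj i j → ε * (H.degree j : ℝ) ≤ (H.degree i : ℝ)) ∧
    (∀ i, ε * ((H.degree i).choose 2 : ℝ) ≤ (ecount (H.induce (H.neighborSet i)) : ℝ)) := by
  constructor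
  · intro i j h
    have h1 := common_ge H ε hε0 hJ i j h
    have h2 : H.neighborFinset i ∩ H.neighborFinset j ⊆ (H.neighborFinset i).erase j := by
      intro x hx
      simp only [Finset.mem_inter, SimpleGraph.mem_neighborFinset] at hx
      simp [hx.1, hx.2.ne']
    have h3 := Finset.card_le_card h2
    have h4 := hiso i
    rw [Finset.card_erase_of_mem (by simpa using h),
      SimpleGraph.card_neighborFinset_eq_degree] at h3
    have h5 : (H.neighborFinset i ∩ H.neighborFinset j).card + 1 ≤ H.degree i := by omega
    have h6 : ((H.neighborFinset i ∩ H.neighborFinset j).card : ℝ) + 1 ≤ H.degree i := by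
      exact_mod_cast h5
    linarith
  · intro i
    have hs := (H.induce (H.neighborSet i)).sum_degrees_eq_twice_card_edges
    have hd : ∀ j : H.neighborSet i, ε * ((H.degree i : ℝ) - 1) ≤
        ((H.induce (H.neighborSet i)).degree j : ℝ) := by
      intro j
      have h1 := common_ge H ε hε0 hJ j i (SimpleGraph.Adj.symm j.2)
      refine h1.trans (le_of_eq ?_)
      rw [← SimpleGraph.card_neighborFinset_eq_degree, ← Finset.card_map
        (Function.Embedding.subtype _)]
      congr 2
      ext x
      simp only [Finset.mem_inter, SimpleGraph.mem_neighborFinset, Finset.mem_map]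
      constructor
      · rintro ⟨a, b⟩
        exact ⟨⟨x, b⟩, a, rfl⟩
      · rintro ⟨⟨y, hy⟩, a, rfl⟩
        exact ⟨a, hy⟩
    have h2 := Finset.sum_le_sum (s := Finset.univ) (fun j _ => hd j)
    rw [Finset.sum_const, Finset.card_univ, SimpleGraph.card_neighborSet_eq_degree,
      nsmul_eq_mul, ← Nat.cast_sum, hs] at h2
    rw [Nat.cast_choose_two]
    unfold ecount
    push_cast at h2
    have h3 : ∀ e : ℝ, (H.degree i : ℝ) * (ε * ((H.degree i : ℝ) - 1)) ≤ 2 * e →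
      ε * ((H.degree i : ℝ) * ((H.degree i : ℝ) - 1) / 2) ≤ e := by
      intro e he
      linarith
    apply h3
    refine h2.trans (le_of_eq ?_)
    congr!
end

section
/- (Sorted-squares lemma) Let x_1 ≥ x_2 ≥ ⋯ ≥ x_n > 0 be real numbers with Σ_{j=1}^n x_j ≤ α and Σ_{j=1}^n x_j² ≥ β, where α, β > 0. Then for every integer r with 1 ≤ r ≤ n and r ≤ 2α²/β, one has Σ_{j=1}^r x_j² ≥ β²·r/(4α²). -/
open Finset

/-- Sorted-squares lemma: for a nonincreasing sequence of positive reals with sum at most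
`α` and sum of squares at least `β`, the first `r ≤ 2α²/β` terms carry at least
`β²·r/(4α²)` of the sum of squares. -/
theorem sorted_squares (n : ℕ) (x : ℕ → ℝ)
    (hpos : ∀ j < n, 0 < x j)
    (hmono : ∀ j k, j ≤ k → k < n → x k ≤ x j)
    (α β : ℝ) (hα : 0 < α) (hβ : 0 < β)
    (hsum : ∑ j ∈ Finset.range n, x j ≤ α)
    (hsq : β ≤ ∑ j ∈ Finset.range n, x j ^ 2)
    (r : ℕ) (hr1 : 1 ≤ r) (hrn : r ≤ n) (hrb : (r : ℝ) ≤ 2 * α ^ 2 / β) :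
    β ^ 2 * (r : ℝ) / (4 * α ^ 2) ≤ ∑ j ∈ Finset.range r, x j ^ 2 := by
  have hT : β ^ 2 * (r : ℝ) / (4 * α ^ 2) = (β / (2 * α)) ^ 2 * r := by
    field_simp
    ring
  have hc0 : 0 < β / (2 * α) := by positivity
  have hcα : β / (2 * α) * α = β / 2 := by field_simp
  rw [hT]
  have hr : (r : ℝ) * β ≤ 2 * α ^ 2 := (le_div_iff₀ hβ).1 hrb
  generalize β / (2 * α) = c at *
  by_cases hy : c ≤ x (r - 1)
  · have h : ∑ j ∈ Finset.range r, c ^ 2 ≤ ∑ j ∈ Finset.range r, x j ^ 2 := by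
      apply Finset.sum_le_sum
      intro j hj
      have hj' := Finset.mem_range.1 hj
      have := hmono j (r - 1) (by omega) (by omega)
      exact pow_le_pow_left₀ hc0.le (hy.trans this) 2
    simp only [Finset.sum_const, Finset.card_range, nsmul_eq_mul] at h
    linarith
  · have hy' := not_le.1 hy
    have h1 : ∑ j ∈ Finset.Ico r n, x j ^ 2 ≤ c * ∑ j ∈ Finset.Ico r n, x j := by
      rw [Finset.mul_sum]
      apply Finset.sum_le_sum
      intro j hj
      have hj' := Finset.mem_Ico.1 hj
      have h2 := hmono (r - 1) j (by omega) hj'.2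
      have h3 := hpos j hj'.2
      nlinarith
    have h4 := Finset.sum_range_add_sum_Ico (fun j => x j) hrn
    have h5 := Finset.sum_range_add_sum_Ico (fun j => x j ^ 2) hrn
    have h6 : 0 ≤ ∑ j ∈ Finset.range r, x j :=
      Finset.sum_nonneg fun j hj => (hpos j (by have := Finset.mem_range.1 hj; omega)).le
    have h7 : c * ∑ j ∈ Finset.Ico r n, x j ≤ c * α :=
      mul_le_mul_of_nonneg_left (by linarith) hc0.le
    have h8 : c ^ 2 * r ≤ β / 2 := by
      have hb : β = 2 * (c * α) := by linarith
      have h9 : (r : ℝ) * c ≤ α := by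
        have : α * ((r : ℝ) * c) ≤ α * α := by rw [hb] at hr; nlinarith
        exact le_of_mul_le_mul_left this hα
      nlinarith
    linarith
end

section
/- Let H be an everywhere ε-triangle dense finite simple graph with ε ∈ (0,1], let i be a vertex, N = N(i), and for each vertex j let θ_j be the number of triangles of H containing j whose other two vertices both lie in N. Then (1) Σ_j √(2θ_j) ≤ Σ_{k∈N} d_k, and (2) Σ_j 2θ_j ≥ (ε/2)·Σ_{k∈N} d_k(H|_N)·d_k, where d_k is the degree of k in H and d_k(H|_N) is the degree of k within the subgraph induced on N. -/
open scoped Classical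
open Finset

theorem two_theta_aux {V : Type*} [Fintype V] [DecidableEq V]
    (H : SimpleGraph V) (i j : V) :
    2 * ((H.cliqueFinset 3).filter
        (fun t => j ∈ t ∧ t.erase j ⊆ H.neighborFinset i)).card =
      ((univ : Finset (V × V)).filter (fun p => H.Adj i p.1 ∧ H.Adj i p.2 ∧
        H.Adj j p.1 ∧ H.Adj j p.2 ∧ H.Adj p.1 p.2)).card := by
  rw [Finset.card_eq_sum_card_fiberwise (f := fun p : V × V => ({j, p.1, p.2} : Finset V))
    (t := (H.cliqueFinset 3).filter (fun t => j ∈ t ∧ t.erase j ⊆ H.neighborFinset i))]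
  · rw [mul_comm, ← smul_eq_mul, ← Finset.sum_const]
    refine Finset.sum_congr rfl ?_
    intro t ht
    rw [Finset.mem_filter, SimpleGraph.mem_cliqueFinset_iff, SimpleGraph.isNClique_iff] at ht
    obtain ⟨⟨hcl, hc⟩, hj, hs⟩ := ht
    have hce : (t.erase j).card = 2 := by rw [Finset.card_erase_of_mem hj, hc]
    have ho : (t.erase j).offDiag.card = 2 := by rw [Finset.offDiag_card, hce]
    rw [← ho]
    congr 1
    ext ⟨a, b⟩
    simp only [Finset.mem_offDiag, Finset.mem_filter, Finset.mem_univ, true_and]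
    constructor
    · rintro ⟨ha, hb, hab⟩
      have ha' := Finset.mem_erase.1 ha
      have hb' := Finset.mem_erase.1 hb
      refine ⟨⟨(H.mem_neighborFinset i a).1 (hs ha), (H.mem_neighborFinset i b).1 (hs hb),
        hcl hj ha'.2 ha'.1.symm, hcl hj hb'.2 hb'.1.symm, hcl ha'.2 hb'.2 hab⟩, ?_⟩
      apply Finset.eq_of_subset_of_card_le
      · intro x hx
        simp only [Finset.mem_insert, Finset.mem_singleton] at hx
        rcases hx with rfl | rfl | rfl
        exacts [hj, ha'.2, hb'.2]
      · rw [hc, Finset.card_eq_three.2 ⟨j, a, b, ha'.1.symm, hb'.1.symm, hab, rfl⟩]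
    · rintro ⟨⟨h1, h2, h3, h4, h5⟩, rfl⟩
      simp [h3.ne', h4.ne', h5.ne]
  · rintro ⟨a, b⟩ hp
    simp only [Finset.coe_filter, Finset.mem_univ, true_and, Set.mem_setOf_eq] at hp ⊢
    obtain ⟨h1, h2, h3, h4, h5⟩ := hp
    refine ⟨?_, by simp, ?_⟩
    · rw [SimpleGraph.mem_cliqueFinset_iff, SimpleGraph.is3Clique_triple_iff]
      exact ⟨h3, h4, h5⟩
    · intro x hx
      simp only [Finset.mem_erase, Finset.mem_insert, Finset.mem_singleton] at hx
      rw [SimpleGraph.mem_neighborFinset]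
      rcases hx with ⟨h, rfl | rfl | rfl⟩
      exacts [absurd rfl h, h1, h2]

theorem common_aux {V : Type*} [Fintype V] [DecidableEq V]
    (H : SimpleGraph V) (ε : ℝ) (hε0 : 0 < ε)
    (hJ : ∀ i j, H.Adj i j → ε ≤ jac H i j) (i k l : V)
    (hk : H.Adj i k) (hl : H.Adj i l) (hkl : H.Adj k l) :
    ε / 2 * (H.degree k : ℝ) ≤ ((H.neighborFinset k ∩ H.neighborFinset l).card : ℝ) := by
  have h := hJ k l hkl
  unfold jac at h
  have hi : ({i, l} : Finset V) ⊆ H.neighborFinset k := by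
    intro x hx
    simp only [Finset.mem_insert, Finset.mem_singleton] at hx
    rw [SimpleGraph.mem_neighborFinset]
    rcases hx with rfl | rfl
    exacts [hk.symm, hkl]
  have h2 : 2 ≤ H.degree k := by
    have := Finset.card_le_card hi
    rwa [Finset.card_pair hl.ne, SimpleGraph.card_neighborFinset_eq_degree] at this
  have hsub : (H.neighborFinset k).erase l ⊆
      (H.neighborFinset k ∪ H.neighborFinset l) \ {k, l} := by
    intro x hx
    simp only [Finset.mem_erase, SimpleGraph.mem_neighborFinset] at hx
    simp [hx.1, hx.2, hx.2.ne']
  have h3 := Finset.card_le_card hsub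
  rw [Finset.card_erase_of_mem (by simpa using hkl),
    SimpleGraph.card_neighborFinset_eq_degree] at h3
  have h4 : (H.degree k : ℝ) ≤
      (((H.neighborFinset k ∪ H.neighborFinset l) \ {k, l}).card : ℝ) + 1 := by
    exact_mod_cast (by omega)
  have h5 : (2 : ℝ) ≤ H.degree k := by exact_mod_cast h2
  rw [le_div_iff₀ (by linarith)] at h
  refine le_trans ?_ h
  rw [div_mul_eq_mul_div, mul_div_assoc]
  exact mul_le_mul_of_nonneg_left (by linarith) hε0.le

/-- Bounds on `Σ_j √(2θ_j)` and `Σ_j 2θ_j`, where `θ_j` counts triangles at `j` whose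
other two vertices lie in `N(i)`. -/
theorem theta_sum_bounds {V : Type*} [Fintype V] [DecidableEq V]
    (H : SimpleGraph V) (ε : ℝ) (hε0 : 0 < ε) (hε1 : ε ≤ 1)
    (hJ : ∀ i j, H.Adj i j → ε ≤ jac H i j)
    (hiso : ∀ v, 0 < H.degree v)
    (i : V)
    (θ : V → ℕ)
    (hθ : ∀ j, θ j =
      ((H.cliqueFinset 3).filter (fun t => j ∈ t ∧ t.erase j ⊆ H.neighborFinset i)).card) :
    (∑ j, Real.sqrt (2 * (θ j : ℝ)) ≤ ∑ k : H.neighborSet i, (H.degree (k : V) : ℝ)) ∧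
    (ε / 2 * ∑ k : H.neighborSet i,
        ((H.induce (H.neighborSet i)).degree k : ℝ) * (H.degree (k : V) : ℝ) ≤
      ∑ j, 2 * (θ j : ℝ)) := by
  have hP := fun j => two_theta_aux H i j
  simp only [← hθ] at hP
  have hN : ∀ f : V → ℝ, ∑ k : H.neighborSet i, f k = ∑ k ∈ H.neighborFinset i, f k := by
    intro f
    symm
    apply Finset.sum_subtype
    intro x
    simp
  constructor
  · have h1 : ∀ j, Real.sqrt (2 * (θ j : ℝ)) ≤
        ((H.neighborFinset i ∩ H.neighborFinset j).card : ℝ) := by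
      intro j
      apply Real.sqrt_le_iff.2 ⟨by positivity, ?_⟩
      have : 2 * θ j ≤ (H.neighborFinset i ∩ H.neighborFinset j).card ^ 2 := by
        rw [hP j, sq, ← Finset.card_product]
        apply Finset.card_le_card
        rintro ⟨a, b⟩ h
        simp only [Finset.mem_filter, Finset.mem_univ, true_and] at h
        simp [h]
      exact_mod_cast this
    refine (Finset.sum_le_sum fun j _ => h1 j).trans ?_
    rw [hN (fun k => (H.degree k : ℝ))]
    apply le_of_eq
    have e1 : ∀ j, ((H.neighborFinset i ∩ H.neighborFinset j).card : ℝ) =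
        ∑ k ∈ H.neighborFinset i, if H.Adj j k then (1 : ℝ) else 0 := by
      intro j
      rw [Finset.sum_boole]
      congr 2
      ext x
      simp
    rw [Finset.sum_congr rfl (fun j _ => e1 j), Finset.sum_comm]
    refine Finset.sum_congr rfl fun k _ => ?_
    rw [Finset.sum_boole, ← SimpleGraph.card_neighborFinset_eq_degree]
    congr 2
    ext x
    simp [H.adj_comm]
  · have hd : ∀ k : H.neighborSet i, ((H.induce (H.neighborSet i)).degree k : ℝ) =
        ∑ l : V, if H.Adj i l ∧ H.Adj (k : V) l then (1 : ℝ) else 0 := by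
      intro k
      rw [Finset.sum_boole, ← SimpleGraph.card_neighborFinset_eq_degree]
      congr 1
      refine Finset.card_bij (fun a _ => (a : V)) ?_ ?_ ?_
      · intro a ha
        have h := a.2
        rw [SimpleGraph.mem_neighborSet] at h
        simpa [h] using ha
      · intro a _ b _ h
        exact Subtype.ext h
      · intro b hb
        simp only [Finset.mem_filter, Finset.mem_univ, true_and] at hb
        exact ⟨⟨b, hb.1⟩, by simpa using hb.2, rfl⟩
    have e2 : ∀ j, 2 * (θ j : ℝ) = ∑ k : V, ∑ l : V,
        if H.Adj i k ∧ H.Adj i l ∧ H.Adj j k ∧ H.Adj j l ∧ H.Adj k l then (1 : ℝ) else 0 := by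
      intro j
      rw [← Finset.sum_product', Finset.univ_product_univ, Finset.sum_boole]
      exact_mod_cast hP j
    rw [Finset.sum_congr rfl (fun j _ => e2 j), Finset.sum_comm]
    simp only [hd]
    rw [hN (fun k => (∑ l : V, if H.Adj i l ∧ H.Adj k l then (1 : ℝ) else 0) *
      (H.degree k : ℝ)), Finset.mul_sum]
    refine le_trans ?_ (Finset.sum_le_sum_of_subset_of_nonneg
      (Finset.subset_univ (H.neighborFinset i)) ?_)
    · refine Finset.sum_le_sum fun k hk => ?_
      rw [SimpleGraph.mem_neighborFinset] at hk
      rw [Finset.sum_comm, Finset.sum_mul, Finset.mul_sum]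
      refine Finset.sum_le_sum fun l _ => ?_
      by_cases h : H.Adj i l ∧ H.Adj k l
      · rw [if_pos h, one_mul]
        refine (common_aux H ε hε0 hJ i k l hk h.1 h.2).trans (le_of_eq ?_)
        rw [Finset.sum_boole]
        congr 2
        ext x
        simp [hk, h.1, h.2, H.adj_comm]
      · rw [if_neg h, zero_mul, mul_zero]
        exact Finset.sum_nonneg fun _ _ => by split_ifs <;> norm_num
    · intro k _ _
      exact Finset.sum_nonneg fun _ _ => Finset.sum_nonneg fun _ _ => by
        split_ifs <;> norm_num
end

section
/- (Main decomposition theorem) There is a universal constant c > 0 such that the following holds. For every τ ∈ (0,1], every ε with 0 < ε ≤ τ/4, and every finite simple graph G with triangle density τ(G) ≥ τ, there exist pairwise disjoint vertex sets V_1, …, V_k of G forming a (c·ε⁴)-tightly-knit family such that the total number of triangles contained in the induced subgraphs G|_{V_1}, …, G|_{V_k} is at least c·ε⁴·t(G). -/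
open scoped Classical
open Finset

namespace TD

variable {V : Type*} [Fintype V] [DecidableEq V]

/-- Neighbourhood. -/
noncomputable def nb (H : SimpleGraph V) (v : V) : Finset V := univ.filter (fun u => H.Adj v u)

/-- Ordered triangles inside `S`. -/
noncomputable def ot (H : SimpleGraph V) (S : Finset V) : Finset (V × V × V) :=
  univ.filter (fun p => (p.1 ∈ S ∧ p.2.1 ∈ S ∧ p.2.2 ∈ S) ∧
    H.Adj p.1 p.2.1 ∧ H.Adj p.2.1 p.2.2 ∧ H.Adj p.1 p.2.2)

/-- Ordered wedges (real valued). -/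
noncomputable def ow (H : SimpleGraph V) : ℝ := ∑ v, ((nb H v).card : ℝ) * ((nb H v).card - 1)

/-- Common neighbours. -/
noncomputable def cn (H : SimpleGraph V) (i j : V) : Finset V := nb H i ∩ nb H j

lemma mem_nb (H : SimpleGraph V) (v u : V) : u ∈ nb H v ↔ H.Adj v u := by simp [nb]

lemma mem_cn (H : SimpleGraph V) (v u z : V) : z ∈ cn H v u ↔ H.Adj v z ∧ H.Adj u z := by
  simp [cn, mem_nb]

lemma mem_ot (H : SimpleGraph V) (S : Finset V) (a b c : V) : (a, b, c) ∈ ot H S ↔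
    (a ∈ S ∧ b ∈ S ∧ c ∈ S) ∧ H.Adj a b ∧ H.Adj b c ∧ H.Adj a c := by simp [ot]

lemma nb_eq_degree (H : SimpleGraph V) (v : V) : (nb H v).card = H.degree v := by
  rw [← SimpleGraph.card_neighborFinset_eq_degree]
  congr 1; ext u; simp [nb]

lemma ow_eq (H : SimpleGraph V) : ow H = 2 * (wcount H : ℝ) := by
  unfold ow wcount
  push_cast
  rw [Finset.mul_sum]
  refine Finset.sum_congr rfl fun v _ => ?_
  rw [Nat.cast_choose_two, nb_eq_degree]; ring

/-- delete an edge -/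
def de (H : SimpleGraph V) (i j : V) : SimpleGraph V where
  Adj a b := H.Adj a b ∧ ¬ ((a = i ∧ b = j) ∨ (a = j ∧ b = i))
  symm := ⟨fun a b h => ⟨h.1.symm, by tauto⟩⟩
  loopless := ⟨fun a h => H.loopless.irrefl a h.1⟩

/-- delete vertices -/
def dv (H : SimpleGraph V) (S : Finset V) : SimpleGraph V where
  Adj a b := H.Adj a b ∧ a ∉ S ∧ b ∉ S
  symm := ⟨fun a b h => ⟨h.1.symm, h.2.2, h.2.1⟩⟩
  loopless := ⟨fun a h => H.loopless.irrefl a h.1⟩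

lemma ot_de (H : SimpleGraph V) (i j : V) :
    (ot H univ).card ≤ (ot (de H i j) univ).card + 6 * (cn H i j).card := by
  have key : ot H univ ⊆ ot (de H i j) univ ∪
      (((cn H i j).image (fun z => (i, j, z)) ∪ (cn H i j).image (fun z => (j, i, z))) ∪
      ((cn H i j).image (fun z => (i, z, j)) ∪ (cn H i j).image (fun z => (j, z, i))) ∪
      ((cn H i j).image (fun z => (z, i, j)) ∪ (cn H i j).image (fun z => (z, j, i)))) := by
    rintro ⟨a, b, c⟩ h
    rw [mem_ot] at h
    simp only [mem_union, mem_ot, mem_image, mem_cn, Prod.mk.injEq, de, mem_univ, true_and]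
    obtain ⟨-, h1, h2, h3⟩ := h
    have h1' := h1.symm
    have h2' := h2.symm
    have h3' := h3.symm
    by_cases c1 : (a = i ∧ b = j) ∨ (a = j ∧ b = i)
    · rcases c1 with ⟨rfl, rfl⟩ | ⟨rfl, rfl⟩ <;> grind
    by_cases c2 : (b = i ∧ c = j) ∨ (b = j ∧ c = i)
    · rcases c2 with ⟨rfl, rfl⟩ | ⟨rfl, rfl⟩ <;> grind
    by_cases c3 : (a = i ∧ c = j) ∨ (a = j ∧ c = i)
    · rcases c3 with ⟨rfl, rfl⟩ | ⟨rfl, rfl⟩ <;> grind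
    left; tauto
  have h := card_le_card key
  have u0 := card_union_le (ot (de H i j) univ) 
      (((cn H i j).image (fun z => (i, j, z)) ∪ (cn H i j).image (fun z => (j, i, z))) ∪
      ((cn H i j).image (fun z => (i, z, j)) ∪ (cn H i j).image (fun z => (j, z, i))) ∪
      ((cn H i j).image (fun z => (z, i, j)) ∪ (cn H i j).image (fun z => (z, j, i))))
  have im : ∀ f g : V → V × V × V, ((cn H i j).image f ∪ (cn H i j).image g).card
      ≤ 2 * (cn H i j).card := by
    intro f g
    have := card_union_le ((cn H i j).image f) ((cn H i j).image g)
    have h1 := card_image_le (s := cn H i j) (f := f)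
    have h2 := card_image_le (s := cn H i j) (f := g)
    omega
  have u1 := card_union_le 
      (((cn H i j).image (fun z => (i, j, z)) ∪ (cn H i j).image (fun z => (j, i, z))) ∪
      ((cn H i j).image (fun z => (i, z, j)) ∪ (cn H i j).image (fun z => (j, z, i))))
      ((cn H i j).image (fun z => (z, i, j)) ∪ (cn H i j).image (fun z => (z, j, i)))
  have u2 := card_union_le 
      ((cn H i j).image (fun z => (i, j, z)) ∪ (cn H i j).image (fun z => (j, i, z)))
      ((cn H i j).image (fun z => (i, z, j)) ∪ (cn H i j).image (fun z => (j, z, i)))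
  have i1 := im (fun z => (i, j, z)) (fun z => (j, i, z))
  have i2 := im (fun z => (i, z, j)) (fun z => (j, z, i))
  have i3 := im (fun z => (z, i, j)) (fun z => (z, j, i))
  omega

lemma mulpred (a b : ℕ) (h : a ≤ b) : (a : ℝ) * (a - 1) ≤ b * (b - 1) := by
  rcases Nat.eq_zero_or_pos a with rfl | ha
  · rcases Nat.eq_zero_or_pos b with rfl | hb
    · simp
    · have : (1 : ℝ) ≤ b := by exact_mod_cast hb
      simp; nlinarith
  · have h1 : (1 : ℝ) ≤ a := by exact_mod_cast ha
    have h2 : (a : ℝ) ≤ b := by exact_mod_cast h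
    nlinarith

lemma ow_mono (H' H : SimpleGraph V) (h : H' ≤ H) : ow H' ≤ ow H := by
  refine Finset.sum_le_sum fun v _ => mulpred _ _ (card_le_card ?_)
  intro u hu; rw [mem_nb] at *; exact h hu

lemma ow_de (H : SimpleGraph V) (i j : V) (hij : H.Adj i j) :
    ow (de H i j) + 2 * ((nb H i).card + (nb H j).card - 2) ≤ ow H := by
  have hne : i ≠ j := hij.ne
  have hi : nb (de H i j) i = (nb H i).erase j := by
    ext u; simp only [mem_nb, de, mem_erase]; grind
  have hj : nb (de H i j) j = (nb H j).erase i := by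
    ext u; simp only [mem_nb, de, mem_erase]; grind
  have ci : ((nb (de H i j) i).card : ℝ) + 1 = (nb H i).card := by
    rw [hi]; exact_mod_cast card_erase_add_one ((mem_nb _ _ _).2 hij)
  have cj : ((nb (de H i j) j).card : ℝ) + 1 = (nb H j).card := by
    rw [hj]; exact_mod_cast card_erase_add_one ((mem_nb _ _ _).2 hij.symm)
  have key : ∑ v ∈ ({i, j} : Finset V), (((nb H v).card : ℝ) * ((nb H v).card - 1) -
      ((nb (de H i j) v).card : ℝ) * ((nb (de H i j) v).card - 1)) ≤ 
      ∑ v, (((nb H v).card : ℝ) * ((nb H v).card - 1) -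
      ((nb (de H i j) v).card : ℝ) * ((nb (de H i j) v).card - 1)) := by
    refine Finset.sum_le_sum_of_subset_of_nonneg (subset_univ _) fun v _ _ => ?_
    refine sub_nonneg.2 (mulpred _ _ (card_le_card ?_))
    intro u hu; rw [mem_nb] at *; exact hu.1
  rw [Finset.sum_pair hne, Finset.sum_sub_distrib, ← ci, ← cj] at key
  rw [← ci, ← cj]
  unfold ow
  linarith

lemma ot_dv (H : SimpleGraph V) (S : Finset V) (d : ℕ) (hd : ∀ v, (nb H v).card ≤ d) :
    (ot H univ).card ≤ (ot (dv H S) univ).card + 3 * (S.card * (d * d)) := by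
  have gen : ∀ f : V → V × V → V × V × V,
      (S.biUnion (fun a => ((nb H a) ×ˢ (nb H a)).image (f a))).card ≤ S.card * (d * d) := by
    intro f
    refine card_biUnion_le_card_mul _ _ _ fun a _ => ?_
    refine card_image_le.trans ?_
    rw [card_product]
    exact Nat.mul_le_mul (hd a) (hd a)
  have key : ot H univ ⊆ ot (dv H S) univ ∪
      (S.biUnion (fun a => ((nb H a) ×ˢ (nb H a)).image (fun p => (a, p.1, p.2))) ∪
      (S.biUnion (fun a => ((nb H a) ×ˢ (nb H a)).image (fun p => (p.1, a, p.2))) ∪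
      S.biUnion (fun a => ((nb H a) ×ˢ (nb H a)).image (fun p => (p.1, p.2, a))))) := by
    rintro ⟨a, b, c⟩ h
    rw [mem_ot] at h
    simp only [mem_union, mem_ot, mem_image, mem_biUnion, mem_product, mem_nb, Prod.mk.injEq, dv,
      mem_univ, true_and, Prod.exists]
    obtain ⟨-, h1, h2, h3⟩ := h
    have h1' := h1.symm
    have h2' := h2.symm
    have h3' := h3.symm
    by_cases c1 : a ∈ S
    · right; left; exact ⟨a, c1, b, c, ⟨h1, h3⟩, rfl, rfl, rfl⟩
    by_cases c2 : b ∈ S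
    · right; right; left; exact ⟨b, c2, a, c, ⟨h1', h2⟩, rfl, rfl, rfl⟩
    by_cases c3 : c ∈ S
    · right; right; right; exact ⟨c, c3, a, b, ⟨h3', h2'⟩, rfl, rfl, rfl⟩
    left; tauto
  have h := card_le_card key
  have g1 := gen (fun a p => (a, p.1, p.2))
  have g2 := gen (fun a p => (p.1, a, p.2))
  have g3 := gen (fun a p => (p.1, p.2, a))
  refine h.trans ((card_union_le _ _).trans ?_)
  refine Nat.add_le_add_left ((card_union_le _ _).trans ?_) _
  have := card_union_le (S.biUnion (fun a => ((nb H a) ×ˢ (nb H a)).image (fun p => (p.1, a, p.2))))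
     (S.biUnion (fun a => ((nb H a) ×ˢ (nb H a)).image (fun p => (p.1, p.2, a))))
  omega

lemma ot_tcount (H : SimpleGraph V) : (ot H univ).card = 6 * tcount H := by
  have hm : ∀ p ∈ ot H univ, ({p.1, p.2.1, p.2.2} : Finset V) ∈ H.cliqueFinset 3 := by
    rintro ⟨a, b, c⟩ h
    rw [mem_ot] at h
    rw [SimpleGraph.mem_cliqueFinset_iff, SimpleGraph.is3Clique_triple_iff]
    exact ⟨h.2.1, h.2.2.2, h.2.2.1⟩
  rw [card_eq_sum_card_fiberwise hm]
  unfold tcount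
  rw [mul_comm, ← smul_eq_mul, ← Finset.sum_const]
  refine Finset.sum_congr rfl fun s hs => ?_
  rw [SimpleGraph.mem_cliqueFinset_iff, SimpleGraph.is3Clique_iff] at hs
  obtain ⟨a, b, c, hab, hac, hbc, rfl⟩ := hs
  have e : (ot H univ).filter (fun p => ({p.1, p.2.1, p.2.2} : Finset V) = {a, b, c}) =
      {(a, b, c), (a, c, b), (b, a, c), (b, c, a), (c, a, b), (c, b, a)} := by
    have n1 := hab.ne
    have n2 := hac.ne
    have n3 := hbc.ne
    ext ⟨x, y, z⟩
    simp only [mem_filter, mem_ot, mem_univ, true_and, mem_insert, mem_singleton, Prod.mk.injEq]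
    constructor
    · rintro ⟨⟨h1, h2, h3⟩, h⟩
      have n4 := h1.ne
      have n5 := h2.ne
      have n6 := h3.ne
      have hx : x ∈ ({a, b, c} : Finset V) := by rw [← h]; simp
      have hy : y ∈ ({a, b, c} : Finset V) := by rw [← h]; simp
      have hz : z ∈ ({a, b, c} : Finset V) := by rw [← h]; simp
      simp only [mem_insert, mem_singleton] at hx hy hz
      clear h h1 h2 h3
      grind
    · have hab' := hab.symm
      have hac' := hac.symm
      have hbc' := hbc.symm
      rintro (⟨rfl, rfl, rfl⟩ | ⟨rfl, rfl, rfl⟩ | ⟨rfl, rfl, rfl⟩ | ⟨rfl, rfl, rfl⟩ |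
        ⟨rfl, rfl, rfl⟩ | ⟨rfl, rfl, rfl⟩) <;> refine ⟨⟨by assumption, by assumption, by assumption⟩, ?_⟩ <;>
        (ext w; simp only [mem_insert, mem_singleton]; try tauto)
  rw [e]
  have n1 := hab.ne
  have n2 := hac.ne
  have n3 := hbc.ne
  have n1' := hab.ne'
  have n2' := hac.ne'
  have n3' := hbc.ne'
  simp [card_insert_of_notMem, *]

lemma ot_induce (G : SimpleGraph V) (S : Finset V) :
    (ot (G.induce (S : Set V)) univ).card = (ot G S).card := by
  refine card_bij (fun p _ => (p.1.1, p.2.1.1, p.2.2.1)) ?_ ?_ ?_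
  · rintro ⟨a, b, c⟩ h
    rw [mem_ot] at *
    exact ⟨⟨a.2, b.2, c.2⟩, h.2⟩
  · rintro ⟨a, b, c⟩ _ ⟨a', b', c'⟩ _ h
    simp only [Prod.mk.injEq] at h ⊢
    exact ⟨Subtype.ext h.1, Subtype.ext h.2.1, Subtype.ext h.2.2⟩
  · rintro ⟨a, b, c⟩ h
    rw [mem_ot] at h
    refine ⟨(⟨a, h.1.1⟩, ⟨b, h.1.2.1⟩, ⟨c, h.1.2.2⟩), ?_, rfl⟩
    rw [mem_ot]
    exact ⟨⟨mem_univ _, mem_univ _, mem_univ _⟩, h.2⟩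

/-- triangle bound from cubic count -/
lemma tau_bound (H : SimpleGraph V) (ρ : ℝ) (h : ρ * (Fintype.card V : ℝ) ^ 3 ≤ (ot H univ).card)
    (h0 : 0 < (ot H univ).card) (hρ : 0 ≤ ρ) : ρ ≤ tau H := by
  have hw : 0 < wcount H := by
    obtain ⟨⟨a, b, c⟩, hp⟩ := card_pos.1 h0
    rw [mem_ot] at hp
    have hd : 2 ≤ H.degree a := by
      rw [← nb_eq_degree, ← card_pair hp.2.2.1.ne]
      refine card_le_card ?_
      intro u hu
      simp only [mem_insert, mem_singleton] at hu
      rw [mem_nb]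
      rcases hu with rfl | rfl
      · exact hp.2.1
      · exact hp.2.2.2
    refine Finset.sum_pos' (fun _ _ => Nat.zero_le _) ⟨a, mem_univ _, Nat.choose_pos hd⟩
  have hw' : (0 : ℝ) < wcount H := by exact_mod_cast hw
  have hub : 2 * (wcount H : ℝ) ≤ (Fintype.card V : ℝ) ^ 3 := by
    rw [← ow_eq]
    unfold ow
    have : ∀ v ∈ (univ : Finset V), ((nb H v).card : ℝ) * ((nb H v).card - 1) ≤ (Fintype.card V : ℝ) ^ 2 := by
      intro v _
      have h1 : ((nb H v).card : ℝ) ≤ Fintype.card V := by exact_mod_cast card_le_univ _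
      have h2 : (0 : ℝ) ≤ (nb H v).card := by positivity
      nlinarith
    refine (Finset.sum_le_card_nsmul _ _ _ this).trans ?_
    rw [nsmul_eq_mul, card_univ]; apply le_of_eq; ring
  rw [ot_tcount] at h
  push_cast at h
  unfold tau
  rw [le_div_iff₀ hw']
  nlinarith [mul_le_mul_of_nonneg_left hub hρ]

lemma edge_bound (H : SimpleGraph V) (ρ : ℝ) (h : ρ * (Fintype.card V : ℝ) ^ 3 ≤ (ot H univ).card)
    (hρ : 0 ≤ ρ) : ρ * (((Fintype.card V).choose 2 : ℕ) : ℝ) ≤ ecount H := by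
  have h1 : (ot H univ).card ≤ (∑ v, H.degree v) * Fintype.card V := by
    have : ot H univ ⊆ (univ : Finset V).biUnion (fun a =>
        ((nb H a) ×ˢ (univ : Finset V)).image (fun p => (a, p.1, p.2))) := by
      rintro ⟨a, b, c⟩ h
      rw [mem_ot] at h
      simp only [mem_biUnion, mem_image, mem_product, mem_nb, mem_univ, true_and, and_true]
      exact ⟨a, (b, c), h.2.1, rfl⟩
    refine (card_le_card this).trans (card_biUnion_le.trans ?_)
    rw [Finset.sum_mul]
    refine Finset.sum_le_sum fun v _ => card_image_le.trans ?_
    rw [card_product, nb_eq_degree, card_univ]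
  rw [SimpleGraph.sum_degrees_eq_twice_card_edges] at h1
  have h2 : ((ot H univ).card : ℝ) ≤ 2 * (ecount H : ℝ) * Fintype.card V := by
    unfold ecount; exact_mod_cast h1
  rw [Nat.cast_choose_two]
  rcases Nat.eq_zero_or_pos (Fintype.card V) with h0 | h0
  · rw [h0]; simp
  have hn : (0 : ℝ) < Fintype.card V := by exact_mod_cast h0
  have h3 : (ρ * (Fintype.card V : ℝ) ^ 2) * Fintype.card V ≤ 2 * (ecount H : ℝ) * Fintype.card V := by
    linarith
  have h4 := le_of_mul_le_mul_right h3 hn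
  nlinarith [mul_nonneg hρ hn.le]

lemma radius_bound (G : SimpleGraph V) (S : Finset V)
    (h : ∃ x ∈ S, ∀ y ∈ S, y = x ∨ ∃ u ∈ S, G.Adj x u ∧ (y = u ∨ G.Adj u y)) :
    ∃ x : ((S : Set V)), ∀ y : ((S : Set V)),
            (G.induce ((S : Set V))).Reachable x y ∧
            (G.induce ((S : Set V))).dist x y ≤ 2 := by
  obtain ⟨x, hx, h⟩ := h
  refine ⟨⟨x, hx⟩, fun y => ?_⟩
  have : ∃ p : (G.induce ((S : Set V))).Walk ⟨x, hx⟩ y, p.length ≤ 2 := by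
    obtain ⟨y, hy⟩ := y
    rcases h y hy with rfl | ⟨u, hu, hxu, rfl | huy⟩
    · exact ⟨.nil, by simp⟩
    · have h1 : (G.induce ((S : Set V))).Adj ⟨x, hx⟩ ⟨y, hy⟩ := hxu
      exact ⟨.cons h1 .nil, by simp⟩
    · have h1 : (G.induce ((S : Set V))).Adj ⟨x, hx⟩ ⟨u, hu⟩ := hxu
      have h2 : (G.induce ((S : Set V))).Adj ⟨u, hu⟩ ⟨y, hy⟩ := huy
      exact ⟨.cons h1 (.cons h2 .nil), by simp⟩
  obtain ⟨p, hp⟩ := this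
  exact ⟨⟨p⟩, (SimpleGraph.dist_le p).trans hp⟩

/-- ordered edges inside `N(v)` forming a triangle with `z` -/
noncomputable def th (H : SimpleGraph V) (v z : V) : Finset (V × V) :=
  ((nb H v ×ˢ nb H v).filter (fun p => H.Adj p.1 p.2)).filter (fun p => z ∈ cn H p.1 p.2)

lemma mem_th (H : SimpleGraph V) (v z a b : V) : (a, b) ∈ th H v z ↔
    ((H.Adj v a ∧ H.Adj v b) ∧ H.Adj a b) ∧ H.Adj a z ∧ H.Adj b z := by
  simp [th, mem_cn, mem_nb]

lemma th_le (H : SimpleGraph V) (v z : V) : (th H v z).card ≤ (cn H z v).card ^ 2 := by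
  rw [pow_two, ← card_product]
  refine card_le_card ?_
  rintro ⟨a, b⟩ h
  rw [mem_th] at h
  rw [mem_product, mem_cn, mem_cn]
  exact ⟨⟨h.2.1.symm, h.1.1.1⟩, ⟨h.2.2.symm, h.1.1.2⟩⟩

lemma sum_cn (H : SimpleGraph V) (v : V) :
    ∑ z, (cn H z v).card = ∑ u ∈ nb H v, (nb H u).card := by
  have h1 : ∀ z, (cn H z v).card = ∑ u ∈ nb H v, if H.Adj z u then 1 else 0 := by
    intro z
    rw [← card_filter]; congr 1; ext u; simp [mem_cn, mem_nb, and_comm]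
  have h2 : ∀ u, (nb H u).card = ∑ z, if H.Adj z u then 1 else 0 := by
    intro u
    rw [← card_filter]; congr 1; ext z; simp [mem_nb, H.adj_comm]
  simp only [h1]
  rw [Finset.sum_comm]
  exact Finset.sum_congr rfl fun u _ => (h2 u).symm

lemma sum_th (H : SimpleGraph V) (v : V) :
    ∑ z, (th H v z).card = ∑ p ∈ (nb H v ×ˢ nb H v).filter (fun p => H.Adj p.1 p.2),
      (cn H p.1 p.2).card := by
  simp only [th, card_filter _ (_ : Finset (V × V))]
  rw [Finset.sum_comm]
  refine Finset.sum_congr rfl fun p _ => ?_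
  rw [← card_filter]; congr 1; ext; simp

lemma sum_P (H : SimpleGraph V) (v : V) (f : V → ℝ) :
    ∑ p ∈ (nb H v ×ˢ nb H v).filter (fun p => H.Adj p.1 p.2), f p.1 =
      ∑ u ∈ nb H v, ((cn H u v).card : ℝ) * f u := by
  rw [Finset.sum_filter, Finset.sum_product]
  refine Finset.sum_congr rfl fun u _ => ?_
  rw [← Finset.sum_filter]
  simp only
  rw [Finset.sum_const, nsmul_eq_mul]
  congr 3; ext w; simp [mem_cn, mem_nb, and_comm]

lemma extract (H : SimpleGraph V) (ε : ℝ) (hε : 0 < ε) (hε1 : ε ≤ 1)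
    (hne : ∃ i j, H.Adj i j)
    (hc : ∀ i j, H.Adj i j → ε * ((nb H i).card + (nb H j).card - 2) < (cn H i j).card) :
    ∃ (S : Finset V) (d : ℕ), 1 ≤ d ∧ (∀ v, (nb H v).card ≤ d) ∧ S.card ≤ 3 * d ∧ S.Nonempty ∧
      (∀ y ∈ S, ∃ z, H.Adj y z) ∧
      (∃ x ∈ S, ∀ y ∈ S, y = x ∨ ∃ u ∈ S, H.Adj x u ∧ (y = u ∨ H.Adj u y)) ∧
      ε ^ 4 * (d : ℝ) ^ 3 / 4 ≤ (ot H S).card := by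
  obtain ⟨i0, j0, hij0⟩ := hne
  obtain ⟨v, -, hv⟩ := Finset.exists_max_image (univ : Finset V) (fun v => (nb H v).card)
    ⟨i0, mem_univ _⟩
  set d := (nb H v).card with hd
  have hd1 : 1 ≤ d := by
    refine le_trans ?_ (hv i0 (mem_univ _))
    exact card_pos.2 ⟨j0, (mem_nb _ _ _).2 hij0⟩
  have hpos : ∀ i j, H.Adj i j → (1 : ℝ) ≤ (nb H i).card := by
    intro i j h
    exact_mod_cast card_pos.2 ⟨j, (mem_nb _ _ _).2 h⟩
  have hcl : ∀ i j, H.Adj i j → ε * (nb H i).card ≤ (cn H i j).card := by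
    intro i j h
    have h0 := hc i j h
    have h1 := hpos i j h
    have h2 := hpos j i h.symm
    have hcpos : (0 : ℝ) < (cn H i j).card := lt_of_le_of_lt (by
      apply mul_nonneg hε.le; linarith) h0
    have hcpos' : 0 < (cn H i j).card := by exact_mod_cast hcpos
    obtain ⟨z, hz⟩ := card_pos.1 hcpos'
    rw [mem_cn] at hz
    have h3 : 2 ≤ (nb H j).card := by
      rw [← card_pair hz.1.ne]
      refine card_le_card ?_
      intro u hu
      simp only [mem_insert, mem_singleton] at hu
      rw [mem_nb]
      rcases hu with rfl | rfl
      · exact h.symm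
      · exact hz.2
    have h4 : (2 : ℝ) ≤ (nb H j).card := by exact_mod_cast h3
    nlinarith
  have hcs : ∀ i j, cn H i j = cn H j i := fun i j => inter_comm _ _
  set D : ℝ := ∑ u ∈ nb H v, ((nb H u).card : ℝ) with hD
  have hdpos : (1 : ℝ) ≤ d := by exact_mod_cast hd1
  -- lower bound on D
  have hDlow : ε * d ^ 2 ≤ D := by
    have : ∀ u ∈ nb H v, ε * d ≤ ((nb H u).card : ℝ) := by
      intro u hu
      rw [mem_nb] at hu
      refine (hcl v u hu).trans ?_
      exact_mod_cast card_le_card inter_subset_right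
    have h := Finset.card_nsmul_le_sum _ _ _ this
    rw [nsmul_eq_mul] at h
    calc ε * d ^ 2 = d * (ε * d) := by ring
      _ ≤ D := h
  have hsum : ε ^ 2 * d * D ≤ ∑ z, ((th H v z).card : ℝ) := by
    have h1 : ∑ z, ((th H v z).card : ℝ) =
        ∑ p ∈ (nb H v ×ˢ nb H v).filter (fun p => H.Adj p.1 p.2), ((cn H p.1 p.2).card : ℝ) := by
      exact_mod_cast sum_th H v
    rw [h1]
    have h2 : ∑ p ∈ (nb H v ×ˢ nb H v).filter (fun p => H.Adj p.1 p.2), ε * ((nb H p.1).card : ℝ)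
        ≤ ∑ p ∈ (nb H v ×ˢ nb H v).filter (fun p => H.Adj p.1 p.2), ((cn H p.1 p.2).card : ℝ) := by
      refine Finset.sum_le_sum fun p hp => ?_
      rw [mem_filter] at hp
      exact hcl _ _ hp.2
    refine le_trans ?_ h2
    rw [sum_P H v (fun u => ε * ((nb H u).card : ℝ)), hD, Finset.mul_sum]
    refine Finset.sum_le_sum fun u hu => ?_
    rw [mem_nb] at hu
    have h3 := hcl v u hu
    rw [hcs] at h3
    have h4 : 0 ≤ ε * ((nb H u).card : ℝ) := by positivity
    calc ε ^ 2 * d * ((nb H u).card : ℝ) = (ε * d) * (ε * ((nb H u).card : ℝ)) := by ring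
      _ ≤ _ := mul_le_mul_of_nonneg_right h3 h4
  have hxs : ∑ z, ((cn H z v).card : ℝ) = D := by
    rw [hD]; exact_mod_cast sum_cn H v
  set s : ℝ := ε ^ 2 * d / 2 with hs
  have hspos : 0 < s := by positivity
  set B : Finset V := univ.filter (fun z => s ^ 2 ≤ ((th H v z).card : ℝ)) with hB
  have hBsum : ε ^ 2 * d * D / 2 ≤ ∑ z ∈ B, ((th H v z).card : ℝ) := by
    have h1 := Finset.sum_filter_add_sum_filter_not (univ : Finset V)
      (fun z => s ^ 2 ≤ ((th H v z).card : ℝ)) (fun z => ((th H v z).card : ℝ))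
    have h2 : ∑ z ∈ univ.filter (fun z => ¬ s ^ 2 ≤ ((th H v z).card : ℝ)), ((th H v z).card : ℝ)
        ≤ ∑ z, s * ((cn H z v).card : ℝ) := by
      refine le_trans (Finset.sum_le_sum (g := fun z => s * ((cn H z v).card : ℝ)) fun z hz => ?_)
        (Finset.sum_le_sum_of_subset_of_nonneg (subset_univ _) fun _ _ _ => by positivity)
      rw [mem_filter] at hz
      have h3 : ((th H v z).card : ℝ) ≤ ((cn H z v).card : ℝ) ^ 2 := by
        exact_mod_cast th_le H v z
      have h4 := not_le.1 hz.2
      have h5 : (0 : ℝ) ≤ (cn H z v).card := by positivity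
      rcases le_total s ((cn H z v).card : ℝ) with h6 | h6 <;> nlinarith
    rw [← Finset.mul_sum, hxs] at h2
    have h3 : s * D = ε ^ 2 * d * D / 2 := by rw [hs]; ring
    linarith
  have hB' : ∃ B' ⊆ B, B'.card ≤ d ∧ ε ^ 4 * (d : ℝ) ^ 3 / 4 ≤ ∑ z ∈ B', ((th H v z).card : ℝ) := by
    rcases le_total B.card d with h | h
    · refine ⟨B, Subset.refl _, h, le_trans ?_ hBsum⟩
      have h1 : ε ^ 2 * d * (ε * d ^ 2) ≤ ε ^ 2 * d * D := by gcongr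
      have h2 : ε ^ 4 * (d : ℝ) ^ 3 ≤ ε ^ 3 * (d : ℝ) ^ 3 :=
        mul_le_mul_of_nonneg_right (pow_le_pow_of_le_one hε.le hε1 (by norm_num)) (by positivity)
      have h3 : 0 ≤ ε ^ 3 * (d : ℝ) ^ 3 := by positivity
      nlinarith
    · obtain ⟨B', hB1, hB2⟩ := Finset.exists_subset_card_eq h
      refine ⟨B', hB1, hB2.le, ?_⟩
      have h1 := Finset.card_nsmul_le_sum B' (fun z => ((th H v z).card : ℝ)) (s ^ 2)
        (fun z hz => (mem_filter.1 (hB1 hz)).2)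
      rw [hB2, nsmul_eq_mul] at h1
      refine le_trans (le_of_eq ?_) h1
      rw [hs]; ring
  obtain ⟨B', hB1, hB2, hB3⟩ := hB'
  have hBn : ∀ z ∈ B', ∃ u, H.Adj v u ∧ H.Adj u z := by
    intro z hz
    have h1 := (mem_filter.1 (hB1 hz)).2
    have h2 : (0 : ℝ) < (th H v z).card := lt_of_lt_of_le (by positivity) h1
    have h3 : 0 < (th H v z).card := by exact_mod_cast h2
    obtain ⟨⟨a, b⟩, hp⟩ := card_pos.1 h3
    rw [mem_th] at hp
    exact ⟨a, hp.1.1.1, hp.2.1⟩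
  refine ⟨insert v (nb H v ∪ B'), d, hd1, fun u => hv u (mem_univ _), ?_, ⟨v, mem_insert_self _ _⟩,
    ?_, ⟨v, mem_insert_self _ _, ?_⟩, ?_⟩
  · have h1 := card_insert_le v (nb H v ∪ B')
    have h2 := card_union_le (nb H v) B'
    omega
  · intro y hy
    simp only [mem_insert, mem_union, mem_nb] at hy
    rcases hy with rfl | hy | hy
    · obtain ⟨u, hu⟩ := card_pos.1 hd1
      exact ⟨u, (mem_nb _ _ _).1 hu⟩
    · exact ⟨v, hy.symm⟩
    · obtain ⟨u, _, hu⟩ := hBn y hy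
      exact ⟨u, hu.symm⟩
  · intro y hy
    simp only [mem_insert, mem_union, mem_nb] at hy ⊢
    rcases hy with rfl | hy | hy
    · exact Or.inl rfl
    · exact Or.inr ⟨y, Or.inr (Or.inl hy), hy, Or.inl rfl⟩
    · obtain ⟨u, hu1, hu2⟩ := hBn y hy
      exact Or.inr ⟨u, Or.inr (Or.inl hu1), hu1, Or.inr hu2⟩
  · refine hB3.trans ?_
    have h1 : (B'.sigma (fun z => th H v z)).card ≤ (ot H (insert v (nb H v ∪ B'))).card := by
      refine card_le_card_of_injOn (fun p => (p.1, p.2.1, p.2.2)) ?_ ?_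
      · rintro ⟨z, a, b⟩ h
        rw [mem_coe, mem_sigma] at h
        obtain ⟨hz, hp⟩ := h
        simp only at hz hp
        rw [mem_th] at hp
        simp only [mem_coe, mem_ot, mem_insert, mem_union, mem_nb]
        exact ⟨⟨by tauto, by tauto, by tauto⟩, hp.2.1.symm, hp.1.2, hp.2.2.symm⟩
      · rintro ⟨z, a, b⟩ _ ⟨z', a', b'⟩ _ h
        simp only [Prod.mk.injEq] at h
        obtain ⟨rfl, rfl, rfl⟩ := h
        rfl
    rw [card_sigma] at h1
    exact_mod_cast h1

lemma ot_mono (H G : SimpleGraph V) (h : H ≤ G) (S : Finset V) : (ot H S).card ≤ (ot G S).card := by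
  refine card_le_card ?_
  rintro ⟨a, b, c⟩ hp
  rw [mem_ot] at *
  exact ⟨hp.1, h hp.2.1, h hp.2.2.1, h hp.2.2.2⟩

/-- A good cluster. -/
def good (G : SimpleGraph V) (ε : ℝ) (S : Finset V) : Prop :=
  (∃ x ∈ S, ∀ y ∈ S, y = x ∨ ∃ u ∈ S, G.Adj x u ∧ (y = u ∨ G.Adj u y)) ∧
  0 < (ot G S).card ∧ ε ^ 4 / 108 * (S.card : ℝ) ^ 3 ≤ (ot G S).card

lemma decomp (G : SimpleGraph V) (ε : ℝ) (hε : 0 < ε) (hε1 : ε ≤ 1) : ∀ (n : ℕ) (H : SimpleGraph V),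
    H ≤ G → (∑ v, (nb H v).card) ≤ n →
    ∃ F : Finset (Finset V), (∀ s ∈ F, ∀ t ∈ F, s ≠ t → Disjoint s t) ∧
      (∀ s ∈ F, good G ε s ∧ ∀ y ∈ s, ∃ z, H.Adj y z) ∧
      ε ^ 4 / 108 * ((ot H univ).card - 3 * ε * ow H) ≤ ∑ s ∈ F, ((ot G s).card : ℝ) := by
  intro n
  induction n using Nat.strong_induction_on with
  | _ n ih =>
  intro H hHG hn
  have hlt : ∀ H' : SimpleGraph V, H' ≤ H → (∃ i j, H.Adj i j ∧ ¬ H'.Adj i j) →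
      (∑ v, (nb H' v).card) < n := by
    intro H' h ⟨i, j, h1, h2⟩
    refine lt_of_lt_of_le (Finset.sum_lt_sum (fun v _ => card_le_card ?_) ⟨i, mem_univ _, card_lt_card ?_⟩) hn
    · intro u hu; rw [mem_nb] at *; exact h hu
    · rw [Finset.ssubset_iff_of_subset]
      · exact ⟨j, (mem_nb _ _ _).2 h1, fun hh => h2 ((mem_nb _ _ _).1 hh)⟩
      · intro u hu; rw [mem_nb] at *; exact h hu
  have hκ : 0 < ε ^ 4 / 108 := by positivity
  by_cases hne : ∃ i j, H.Adj i j
  swap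
  · refine ⟨∅, by simp, by simp, ?_⟩
    have h1 : (ot H univ) = ∅ := by
      rw [eq_empty_iff_forall_notMem]
      rintro ⟨a, b, c⟩ h
      rw [mem_ot] at h
      exact hne ⟨a, b, h.2.1⟩
    have h2 : 0 ≤ ow H := by
      refine Finset.sum_nonneg fun v _ => ?_
      have := mulpred 0 (nb H v).card (Nat.zero_le _)
      simpa using this
    rw [h1]
    simp only [card_empty, sum_empty, Nat.cast_zero]
    have : 0 ≤ ε ^ 4 / 108 * (3 * ε * ow H) := by positivity
    linarith
  by_cases hc : ∀ i j, H.Adj i j → ε * ((nb H i).card + (nb H j).card - 2) < (cn H i j).card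
  · obtain ⟨S, d, hd1, hdeg, hS, hSne, hSadj, hrad, hot⟩ := extract H ε hε hε1 hne hc
    have hle : dv H S ≤ H := fun a b h => h.1
    obtain ⟨x, hx⟩ := hSne
    obtain ⟨z, hz⟩ := hSadj x hx
    obtain ⟨F, hF1, hF2, hF3⟩ := ih _ (hlt (dv H S) hle ⟨x, z, hz, fun h => h.2.1 hx⟩) (dv H S)
      (hle.trans hHG) le_rfl
    have hdisj : ∀ s ∈ F, Disjoint S s := by
      intro s hs
      rw [Finset.disjoint_left]
      intro y hy hy'
      obtain ⟨z, hz⟩ := (hF2 s hs).2 y hy'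
      exact hz.2.1 hy
    have hSF : S ∉ F := by
      intro h
      exact Finset.disjoint_left.1 (hdisj S h) hx hx
    have hdpos : (1 : ℝ) ≤ d := by exact_mod_cast hd1
    have hotG : ε ^ 4 * (d : ℝ) ^ 3 / 4 ≤ (ot G S).card :=
      hot.trans (by exact_mod_cast ot_mono H G hHG S)
    have hSr : (S.card : ℝ) ≤ 3 * d := by exact_mod_cast hS
    refine ⟨insert S F, ?_, ?_, ?_⟩
    · intro s hs t ht hst
      rw [mem_insert] at hs ht
      rcases hs with rfl | hs <;> rcases ht with rfl | ht
      · exact absurd rfl hst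
      · exact hdisj _ ht
      · exact (hdisj _ hs).symm
      · exact hF1 s hs t ht hst
    · intro s hs
      rw [mem_insert] at hs
      rcases hs with rfl | hs
      · refine ⟨⟨?_, ?_, ?_⟩, hSadj⟩
        · obtain ⟨x, hx, h⟩ := hrad
          refine ⟨x, hx, fun y hy => ?_⟩
          rcases h y hy with h | ⟨u, hu, h1, h2⟩
          · exact Or.inl h
          · exact Or.inr ⟨u, hu, hHG h1, h2.imp id (fun h => hHG h)⟩
        · have : (0 : ℝ) < (ot G s).card := lt_of_lt_of_le (by positivity) hotG
          exact_mod_cast this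
        · refine le_trans ?_ hotG
          have : (s.card : ℝ) ^ 3 ≤ (3 * d) ^ 3 := by gcongr
          calc ε ^ 4 / 108 * (s.card : ℝ) ^ 3 ≤ ε ^ 4 / 108 * (3 * d) ^ 3 := by gcongr
            _ = _ := by ring
      · refine ⟨(hF2 s hs).1, fun y hy => ?_⟩
        obtain ⟨z, hz⟩ := (hF2 s hs).2 y hy
        exact ⟨z, hz.1⟩
    · rw [Finset.sum_insert hSF]
      have h1 : ((ot H univ).card : ℝ) ≤ (ot (dv H S) univ).card + 3 * (S.card * (d * d)) := by
        exact_mod_cast ot_dv H S d hdeg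
      have h2 := ow_mono _ _ hle
      have h3 : (S.card : ℝ) * (d * d) ≤ 3 * d * (d * d) := by gcongr
      have h4 : ((ot H univ).card : ℝ) - 3 * ε * ow H ≤
          ((ot (dv H S) univ).card - 3 * ε * ow (dv H S)) + 9 * d ^ 3 := by
        have := mul_le_mul_of_nonneg_left h2 hε.le
        nlinarith
      have h5 := mul_le_mul_of_nonneg_left h4 hκ.le
      have h6 : 0 ≤ ε ^ 4 * (d : ℝ) ^ 3 := by positivity
      nlinarith
  · push Not at hc
    obtain ⟨i, j, hij, hb⟩ := hc
    have hle : de H i j ≤ H := fun a b h => h.1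
    obtain ⟨F, hF1, hF2, hF3⟩ := ih _ (hlt (de H i j) hle ⟨i, j, hij, fun h => h.2 (Or.inl ⟨rfl, rfl⟩)⟩)
      (de H i j) (hle.trans hHG) le_rfl
    refine ⟨F, hF1, fun s hs => ⟨(hF2 s hs).1, fun y hy => ?_⟩, le_trans ?_ hF3⟩
    · obtain ⟨z, hz⟩ := (hF2 s hs).2 y hy
      exact ⟨z, hz.1⟩
    · refine mul_le_mul_of_nonneg_left ?_ hκ.le
      have h1 : ((ot H univ).card : ℝ) ≤ (ot (de H i j) univ).card + 6 * (cn H i j).card := by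
        exact_mod_cast ot_de H i j
      have h2 := mul_le_mul_of_nonneg_left (ow_de H i j hij) hε.le
      nlinarith

end TD

/-- Main decomposition theorem: every `τ`-triangle dense graph admits a
`(c·ε⁴)`-tightly-knit family (disjoint vertex sets whose induced subgraphs are
`c·ε⁴`-edge dense, have triangle density at least `c·ε⁴`, and radius at most `2`)
containing a `c·ε⁴` fraction of the triangles, for any `0 < ε ≤ τ/4`. -/
theorem main_decomposition :
    ∃ c : ℝ, 0 < c ∧
      ∀ (V : Type) [Fintype V] [DecidableEq V] (G : SimpleGraph V) (τ ε : ℝ),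
        0 < τ → τ ≤ 1 → 0 < ε → ε ≤ τ / 4 → τ ≤ tau G →
        ∃ (k : ℕ) (Vs : Fin k → Finset V),
          (∀ a b, a ≠ b → Disjoint (Vs a) (Vs b)) ∧
          (∀ a, c * ε ^ 4 * (((Vs a).card.choose 2 : ℕ) : ℝ) ≤
            (ecount (G.induce ((Vs a : Set V))) : ℝ)) ∧
          (∀ a, c * ε ^ 4 ≤ tau (G.induce ((Vs a : Set V)))) ∧
          (∀ a, ∃ x : ((Vs a : Set V)), ∀ y : ((Vs a : Set V)),
            (G.induce ((Vs a : Set V))).Reachable x y ∧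
            (G.induce ((Vs a : Set V))).dist x y ≤ 2) ∧
          c * ε ^ 4 * (tcount G : ℝ) ≤ ∑ a, (tcount (G.induce ((Vs a : Set V))) : ℝ) := by
  refine ⟨1 / 432, by norm_num, ?_⟩
  intro V _ _ G τ ε hτ hτ1 hε hετ hG
  have hε1 : ε ≤ 1 := by linarith
  obtain ⟨F, hF1, hF2, hF3⟩ := TD.decomp G ε hε hε1 _ G le_rfl le_rfl
  have hcard : ∀ s : Finset V, Fintype.card ((s : Set V)) = s.card := fun s => by simp
  have hcl : ∀ s ∈ F, 1 / 432 * ε ^ 4 * ((Fintype.card ((s : Set V)) : ℕ) : ℝ) ^ 3 ≤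
      (TD.ot (G.induce (s : Set V)) univ).card := by
    intro s hs
    have h := (hF2 s hs).1.2.2
    rw [TD.ot_induce, hcard s]
    refine le_trans ?_ h
    have : 0 ≤ ε ^ 4 * (s.card : ℝ) ^ 3 := by positivity
    linarith
  have hρ : 0 ≤ 1 / 432 * ε ^ 4 := by positivity
  refine ⟨F.card, fun a => (F.equivFin.symm a : Finset V), ?_, ?_, ?_, ?_, ?_⟩
  · intro a b hab
    refine hF1 _ (F.equivFin.symm a).2 _ (F.equivFin.symm b).2 fun h => hab ?_
    exact F.equivFin.symm.injective (Subtype.ext h)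
  · intro a
    have h := TD.edge_bound _ _ (hcl _ (F.equivFin.symm a).2) hρ
    rw [hcard] at h
    exact h
  · intro a
    refine TD.tau_bound _ _ (hcl _ (F.equivFin.symm a).2) ?_ hρ
    rw [TD.ot_induce]
    exact (hF2 _ (F.equivFin.symm a).2).1.2.1
  · intro a
    exact TD.radius_bound _ _ (hF2 _ (F.equivFin.symm a).2).1.1
  · have e1 : ∑ a, (tcount (G.induce (((F.equivFin.symm a : Finset V)) : Set V)) : ℝ) =
        ∑ s ∈ F, (tcount (G.induce (s : Set V)) : ℝ) := by
      rw [← Finset.sum_coe_sort F]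
      exact Equiv.sum_comp F.equivFin.symm (fun s : F => (tcount (G.induce ((s : Finset V) : Set V)) : ℝ))
    rw [e1]
    have e2 : ∑ s ∈ F, ((TD.ot G s).card : ℝ) = 6 * ∑ s ∈ F, (tcount (G.induce (s : Set V)) : ℝ) := by
      rw [Finset.mul_sum]
      refine Finset.sum_congr rfl fun s _ => ?_
      rw [← TD.ot_induce, TD.ot_tcount]; push_cast; rfl
    rw [e2, TD.ot_tcount, TD.ow_eq] at hF3
    push_cast at hF3
    have hw : 0 < (wcount G : ℝ) := by
      rcases Nat.eq_zero_or_pos (wcount G) with h | h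
      · unfold tau at hG
        rw [h] at hG
        simp at hG
        linarith
      · exact_mod_cast h
    unfold tau at hG
    rw [le_div_iff₀ hw] at hG
    have h1 : ε * wcount G ≤ τ / 4 * wcount G := mul_le_mul_of_nonneg_right hετ hw.le
    have h2 : 3 / 2 * (tcount G : ℝ) ≤ 6 * (tcount G : ℝ) - 3 * ε * (2 * wcount G) := by linarith
    have h3 := mul_le_mul_of_nonneg_left h2 (by positivity : 0 ≤ ε ^ 4 / 108)
    linarith
end

section
/- (Triangle-weight lower bound) Let G be a finite simple graph, γ ∈ (0,1], and let g be the number of good edges of G. Then the total triangle weight satisfies r(T) ≥ γ·g, where T is the set of all triangles of G. In particular, if at least a μ fraction of the edges of G are good, then r(T) ≥ γ·μ·|E(G)|. -/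
open scoped Classical
open Finset

/-- `i` and `j` are joined by a good edge: adjacent with Jaccard similarity at least `γ`. -/
def goodAdj {V : Type*} [Fintype V] [DecidableEq V] (G : SimpleGraph V) (γ : ℝ)
    (i j : V) : Prop :=
  G.Adj i j ∧ γ ≤ jac G i j

/-- Weight of a triangle (given as its vertex set `t`): the sum of `1/(d_v − 1)` over the
vertices `v` of `t` incident to at least one good edge of `t`.  This equals
`1/d'_{i₁} + 1/d'_{i₂} + 1/d'_{i₃}` when `t` has at least two good edges,
`1/d'_{i₁} + 1/d'_{i₂}` when `{i₁,i₂}` is the only good edge, and `0` otherwise. -/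
noncomputable def triWeight {V : Type*} [Fintype V] [DecidableEq V] (G : SimpleGraph V)
    (γ : ℝ) (t : Finset V) : ℝ :=
  ∑ v ∈ t, if ∃ u ∈ t, goodAdj G γ v u then 1 / ((G.degree v : ℝ) - 1) else 0

lemma jac_comm' {V : Type*} [Fintype V] [DecidableEq V] (G : SimpleGraph V) (i j : V) :
    jac G i j = jac G j i := by
  unfold jac
  rw [Finset.inter_comm, Finset.union_comm, Finset.pair_comm]

/-- The graph of good edges. -/
def goodGraph {V : Type*} [Fintype V] [DecidableEq V] (G : SimpleGraph V) (γ : ℝ) :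
    SimpleGraph V where
  Adj i j := goodAdj G γ i j
  symm := ⟨fun i j h => ⟨h.1.symm, by rw [jac_comm']; exact h.2⟩⟩
  loopless := ⟨fun i h => G.loopless.irrefl i h.1⟩

lemma sum_good {V : Type*} [Fintype V] [DecidableEq V] (G : SimpleGraph V) (γ : ℝ) :
    ∑ v, ∑ u, (if goodAdj G γ v u then (1 : ℝ) else 0) =
      2 * ((G.edgeFinset.filter (fun e => ∀ i j, e = s(i, j) → γ ≤ jac G i j)).card : ℝ) := by
  have h := (goodGraph G γ).sum_degrees_eq_twice_card_edges
  have h1 : (goodGraph G γ).edgeFinset =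
      G.edgeFinset.filter (fun e => ∀ i j, e = s(i, j) → γ ≤ jac G i j) := by
    ext e
    induction e using Sym2.ind with
    | _ x y =>
      simp only [SimpleGraph.mem_edgeFinset, SimpleGraph.mem_edgeSet, Finset.mem_filter]
      constructor
      · rintro ⟨h1, h2⟩
        refine ⟨h1, fun i j hij => ?_⟩
        rcases Sym2.eq_iff.1 hij with ⟨rfl, rfl⟩ | ⟨rfl, rfl⟩
        · exact h2
        · rw [jac_comm']; exact h2
      · rintro ⟨h1, h2⟩
        exact ⟨h1, h2 x y rfl⟩
  rw [h1] at h
  have h2 : ∀ v, ∑ u, (if goodAdj G γ v u then (1 : ℝ) else 0) =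
      ((goodGraph G γ).degree v : ℝ) := by
    intro v
    rw [Finset.sum_boole]
    congr 1
    rw [← SimpleGraph.card_neighborFinset_eq_degree]
    congr 1
    ext u
    rw [SimpleGraph.mem_neighborFinset]
    simp only [Finset.mem_filter, Finset.mem_univ, true_and]
    exact Iff.rfl
  rw [Finset.sum_congr rfl (fun v _ => h2 v)]
  exact_mod_cast h

lemma good_inter {V : Type*} [Fintype V] [DecidableEq V] (G : SimpleGraph V) (γ : ℝ)
    (hγ0 : 0 < γ) {v u : V} (h : goodAdj G γ v u) :
    0 < (G.degree v : ℝ) - 1 ∧ γ * ((G.degree v : ℝ) - 1) ≤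
      ((G.neighborFinset v ∩ G.neighborFinset u).card : ℝ) := by
  obtain ⟨ha, hj⟩ := h
  unfold jac at hj
  have hm : u ∈ G.neighborFinset v := by simpa using ha
  have he : ((G.neighborFinset v).erase u).card + 1 = G.degree v := by
    rw [Finset.card_erase_add_one hm, SimpleGraph.card_neighborFinset_eq_degree]
  have her : (G.degree v : ℝ) - 1 = (((G.neighborFinset v).erase u).card : ℝ) := by
    rw [← he]; push_cast; ring
  have hle : ((G.neighborFinset v).erase u).card ≤
      ((G.neighborFinset v ∪ G.neighborFinset u) \ {v, u}).card := by
    apply Finset.card_le_card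
    intro x hx
    simp only [Finset.mem_erase, SimpleGraph.mem_neighborFinset] at hx
    simp only [Finset.mem_sdiff, Finset.mem_union, SimpleGraph.mem_neighborFinset,
      Finset.mem_insert, Finset.mem_singleton, not_or]
    exact ⟨Or.inl hx.2, hx.2.ne', hx.1⟩
  have hle2 : (G.neighborFinset v ∩ G.neighborFinset u).card ≤
      ((G.neighborFinset v).erase u).card := by
    apply Finset.card_le_card
    intro x hx
    simp only [Finset.mem_inter, SimpleGraph.mem_neighborFinset] at hx
    simp only [Finset.mem_erase, SimpleGraph.mem_neighborFinset]
    exact ⟨hx.2.ne', hx.1⟩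
  have hpos : (0 : ℝ) < (((G.neighborFinset v ∪ G.neighborFinset u) \ {v, u}).card : ℝ) := by
    by_contra hc
    have h0 : (((G.neighborFinset v ∪ G.neighborFinset u) \ {v, u}).card : ℝ) = 0 :=
      le_antisymm (not_lt.1 hc) (Nat.cast_nonneg _)
    rw [h0, div_zero] at hj
    linarith
  rw [le_div_iff₀ hpos] at hj
  have hleR : (((G.neighborFinset v).erase u).card : ℝ) ≤
      (((G.neighborFinset v ∪ G.neighborFinset u) \ {v, u}).card : ℝ) := by exact_mod_cast hle
  have hle2R : ((G.neighborFinset v ∩ G.neighborFinset u).card : ℝ) ≤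
      (((G.neighborFinset v).erase u).card : ℝ) := by exact_mod_cast hle2
  rw [her]
  constructor
  · have := mul_pos hγ0 hpos
    linarith
  · exact (mul_le_mul_of_nonneg_left hleR hγ0.le).trans hj

lemma inter_le_tri {V : Type*} [Fintype V] [DecidableEq V] (G : SimpleGraph V)
    {v u : V} (h : G.Adj v u) :
    (G.neighborFinset v ∩ G.neighborFinset u).card ≤
      ((G.cliqueFinset 3).filter (fun t => v ∈ t ∧ u ∈ t)).card := by
  apply Finset.card_le_card_of_injOn (fun w => {v, u, w})
  · intro w hw
    simp only [Finset.coe_inter, Set.mem_inter_iff, Finset.mem_coe,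
      SimpleGraph.mem_neighborFinset] at hw
    simp only [Finset.coe_filter, Set.mem_ofPred_eq, SimpleGraph.mem_cliqueFinset_iff]
    refine ⟨SimpleGraph.is3Clique_triple_iff.2 ⟨h, hw.1, hw.2⟩, by simp, by simp⟩
  · intro w hw x hx hwx
    simp only [Finset.coe_inter, Set.mem_inter_iff, Finset.mem_coe,
      SimpleGraph.mem_neighborFinset] at hw hx
    have : w ∈ ({v, u, x} : Finset V) := by
      have h2 : w ∈ ({v, u, w} : Finset V) := by simp
      have h3 : ({v, u, w} : Finset V) = {v, u, x} := hwx
      rwa [h3] at h2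
    simp only [Finset.mem_insert, Finset.mem_singleton] at this
    rcases this with rfl | rfl | rfl
    · exact absurd rfl hw.1.ne
    · exact absurd rfl hw.2.ne
    · rfl

lemma triWeight_ge {V : Type*} [Fintype V] [DecidableEq V] (G : SimpleGraph V) (γ : ℝ)
    (t : Finset V) (ht : t.card = 3) :
    ∑ v, ∑ u, (if v ∈ t ∧ u ∈ t then
      (if goodAdj G γ v u then 1 / ((G.degree v : ℝ) - 1) else 0) else 0) ≤
      2 * triWeight G γ t := by
  unfold triWeight
  rw [Finset.mul_sum, ← Finset.sum_subset (Finset.subset_univ t)]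
  · apply Finset.sum_le_sum
    intro v hv
    simp only [hv, true_and]
    rw [← Finset.sum_filter, ← Finset.sum_filter, Finset.sum_const, nsmul_eq_mul]
    split_ifs with hex
    · obtain ⟨u, hu, hg⟩ := hex
      have hd : (1 : ℝ) ≤ (G.degree v : ℝ) := by
        have : 0 < G.degree v := (G.degree_pos_iff_exists_adj v).2 ⟨u, hg.1⟩
        exact_mod_cast this
      apply mul_le_mul_of_nonneg_right _ (div_nonneg zero_le_one (by linarith))
      have hc : (((Finset.univ.filter (fun u => u ∈ t)).filter
          (fun u => goodAdj G γ v u)).card) ≤ (t.erase v).card := by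
        apply Finset.card_le_card
        intro x hx
        simp only [Finset.mem_filter, Finset.mem_univ, true_and] at hx
        exact Finset.mem_erase.2 ⟨hx.2.1.ne', hx.1⟩
      rw [Finset.card_erase_of_mem hv, ht] at hc
      exact_mod_cast hc
    · have : ((Finset.univ.filter (fun u => u ∈ t)).filter
          (fun u => goodAdj G γ v u)) = ∅ := by
        ext x
        simp only [Finset.mem_filter, Finset.mem_univ, true_and, Finset.notMem_empty, iff_false]
        rintro ⟨h1, h2⟩
        exact hex ⟨x, h1, h2⟩
      rw [this]; simp
  · intro v _ hv
    simp [hv]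

lemma main_bound {V : Type*} [Fintype V] [DecidableEq V]
    (G : SimpleGraph V) (γ : ℝ) (hγ0 : 0 < γ) :
    γ * ((G.edgeFinset.filter (fun e => ∀ i j, e = s(i, j) → γ ≤ jac G i j)).card : ℝ) ≤
      ∑ t ∈ G.cliqueFinset 3, triWeight G γ t := by
  have h1 := Finset.sum_le_sum (s := G.cliqueFinset 3) (fun t ht =>
    triWeight_ge G γ t ((SimpleGraph.mem_cliqueFinset_iff.1 ht).card_eq))
  rw [← Finset.mul_sum, Finset.sum_comm] at h1
  have h2 : γ * ∑ v, ∑ u, (if goodAdj G γ v u then (1 : ℝ) else 0) ≤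
      ∑ v, ∑ t ∈ G.cliqueFinset 3, ∑ u, (if v ∈ t ∧ u ∈ t then
      (if goodAdj G γ v u then 1 / ((G.degree v : ℝ) - 1) else 0) else 0) := by
    rw [Finset.mul_sum]
    apply Finset.sum_le_sum
    intro v _
    rw [Finset.mul_sum, Finset.sum_comm]
    apply Finset.sum_le_sum
    intro u _
    rw [← Finset.sum_filter, Finset.sum_const, nsmul_eq_mul]
    split_ifs with hg
    · obtain ⟨hp, hle⟩ := good_inter G γ hγ0 hg
      have h3 : ((G.neighborFinset v ∩ G.neighborFinset u).card : ℝ) ≤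
        (((G.cliqueFinset 3).filter (fun t => v ∈ t ∧ u ∈ t)).card : ℝ) := by
        exact_mod_cast inter_le_tri G hg.1
      rw [mul_one, mul_one_div, le_div_iff₀ hp]
      convert hle.trans h3
    · simp
  rw [sum_good] at h2
  linarith

/-- Triangle-weight lower bound: `r(T) ≥ γ·g` where `g` is the number of good edges; in
particular if at least a `μ` fraction of edges are good then `r(T) ≥ γ·μ·|E|`. -/
theorem triangle_weight_lower_bound {V : Type*} [Fintype V] [DecidableEq V]
    (G : SimpleGraph V) (γ : ℝ) (hγ0 : 0 < γ) (hγ1 : γ ≤ 1) :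
    γ * ((G.edgeFinset.filter (fun e => ∀ i j, e = s(i, j) → γ ≤ jac G i j)).card : ℝ) ≤
      ∑ t ∈ G.cliqueFinset 3, triWeight G γ t ∧
    ∀ μ : ℝ, μ * (ecount G : ℝ) ≤
        ((G.edgeFinset.filter (fun e => ∀ i j, e = s(i, j) → γ ≤ jac G i j)).card : ℝ) →
      γ * μ * (ecount G : ℝ) ≤ ∑ t ∈ G.cliqueFinset 3, triWeight G γ t := by
  refine ⟨main_bound G γ hγ0, fun μ hμ => ?_⟩
  have h := main_bound G γ hγ0
  have h2 := mul_le_mul_of_nonneg_left hμ hγ0.le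
  rw [mul_assoc]
  exact h2.trans h
end

section
/- (Cleaning a good edge) Let G be a finite simple graph, γ ∈ (0,1], and let H be a spanning subgraph of G. Suppose e = {i,j} is an edge of H that is a good edge of G and whose Jaccard similarity computed in H is at most ε. Let T_e(H) be the set of triangles of H containing e and W_e(H) the set of wedges of H containing e. Then r(T_e(H)) ≤ (3ε/γ²)·r(W_e(H)), where all weights r are computed from the degrees and good edges of the original graph G. -/
open scoped Classical
open Finset

/-- Weight of a wedge with central vertex `c` and endpoint pair `p`, computed from the
degrees and good edges of `G`. -/
noncomputable def wedgeWeight {V : Type*} [Fintype V] [DecidableEq V] (G : SimpleGraph V)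
    (γ : ℝ) (c : V) (p : Finset V) : ℝ :=
  if ∃ j ∈ p, goodAdj G γ c j then 1 / ((G.degree c : ℝ) - 1) else 0

lemma good_bound {V : Type*} [Fintype V] [DecidableEq V] (G : SimpleGraph V) (γ : ℝ)
    (hγ0 : 0 < γ) (x y : V) (h : goodAdj G γ x y) :
    0 < (G.degree x : ℝ) - 1 ∧ 0 < (G.degree y : ℝ) - 1 ∧
      γ * ((G.degree x : ℝ) - 1) ≤ (G.degree y : ℝ) - 1 ∧
      γ * ((G.degree y : ℝ) - 1) ≤ (G.degree x : ℝ) - 1 := by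
  obtain ⟨hxy, hj⟩ := h
  unfold jac at hj
  have hdx : ((G.neighborFinset x).erase y).card + 1 = G.degree x := by
    rw [Finset.card_erase_add_one (by simpa using hxy), SimpleGraph.card_neighborFinset_eq_degree]
  have hdy : ((G.neighborFinset y).erase x).card + 1 = G.degree y := by
    rw [Finset.card_erase_add_one (by simpa using hxy.symm),
      SimpleGraph.card_neighborFinset_eq_degree]
  have h1 : (G.neighborFinset x ∩ G.neighborFinset y).card ≤
      ((G.neighborFinset x).erase y).card := by
    apply Finset.card_le_card
    intro k hk
    simp only [mem_inter, SimpleGraph.mem_neighborFinset, mem_erase] at hk ⊢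
    exact ⟨hk.2.ne', hk.1⟩
  have h2 : (G.neighborFinset x ∩ G.neighborFinset y).card ≤
      ((G.neighborFinset y).erase x).card := by
    apply Finset.card_le_card
    intro k hk
    simp only [mem_inter, SimpleGraph.mem_neighborFinset, mem_erase] at hk ⊢
    exact ⟨hk.1.ne', hk.2⟩
  have h3 : ((G.neighborFinset x).erase y).card ≤
      ((G.neighborFinset x ∪ G.neighborFinset y) \ {x, y}).card := by
    apply Finset.card_le_card
    intro k hk
    simp only [mem_sdiff, mem_union, mem_insert, mem_singleton,
      SimpleGraph.mem_neighborFinset, mem_erase] at hk ⊢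
    have := hk.2.ne'
    tauto
  have h4 : ((G.neighborFinset y).erase x).card ≤
      ((G.neighborFinset x ∪ G.neighborFinset y) \ {x, y}).card := by
    apply Finset.card_le_card
    intro k hk
    simp only [mem_sdiff, mem_union, mem_insert, mem_singleton,
      SimpleGraph.mem_neighborFinset, mem_erase] at hk ⊢
    have := hk.2.ne'
    tauto
  have hU : (0 : ℝ) < (((G.neighborFinset x ∪ G.neighborFinset y) \ {x, y}).card : ℝ) := by
    rcases (Nat.cast_nonneg (α := ℝ)
      ((G.neighborFinset x ∪ G.neighborFinset y) \ {x, y}).card).eq_or_lt with h0 | h0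
    · rw [← h0, div_zero] at hj
      linarith
    · exact h0
  rw [le_div_iff₀ hU] at hj
  have hc := mul_pos hγ0 hU
  rw [← hdx, ← hdy]
  push_cast
  have h1' : ((G.neighborFinset x ∩ G.neighborFinset y).card : ℝ) ≤
      ((G.neighborFinset x).erase y).card := by exact_mod_cast h1
  have h2' : ((G.neighborFinset x ∩ G.neighborFinset y).card : ℝ) ≤
      ((G.neighborFinset y).erase x).card := by exact_mod_cast h2
  have h3' : (((G.neighborFinset x).erase y).card : ℝ) ≤
      ((G.neighborFinset x ∪ G.neighborFinset y) \ {x, y}).card := by exact_mod_cast h3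
  have h4' : (((G.neighborFinset y).erase x).card : ℝ) ≤
      ((G.neighborFinset x ∪ G.neighborFinset y) \ {x, y}).card := by exact_mod_cast h4
  have h5 := mul_le_mul_of_nonneg_left h3' hγ0.le
  have h6 := mul_le_mul_of_nonneg_left h4' hγ0.le
  refine ⟨?_, ?_, ?_, ?_⟩ <;> linarith

lemma wedge_sum {V : Type*} [Fintype V] [DecidableEq V] (G : SimpleGraph V) (γ : ℝ)
    (hγ0 : 0 < γ) (x y : V) (h : goodAdj G γ x y) (N : Finset V) (M : ℝ)
    (hM : (G.degree x : ℝ) - 1 ≤ M) :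
    ((N.erase y).card : ℝ) * (1 / M) * (if y ∈ N then 1 else 0) ≤
      ∑ p ∈ (N.powersetCard 2).filter (fun p => y ∈ p), wedgeWeight G γ x p := by
  have hx := (good_bound G γ hγ0 x y h).1
  have h1 : ∀ p ∈ (N.powersetCard 2).filter (fun p => y ∈ p), 1 / M ≤ wedgeWeight G γ x p := by
    intro p hp
    rw [mem_filter] at hp
    unfold wedgeWeight
    rw [if_pos ⟨y, hp.2, h⟩]
    exact one_div_le_one_div_of_le hx hM
  have h2 := Finset.card_nsmul_le_sum _ _ _ h1
  have hM0 : 0 ≤ 1 / M := by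
    have : 0 < M := by linarith
    positivity
  refine le_trans ?_ h2
  rw [nsmul_eq_mul]
  split_ifs with hy
  · rw [mul_one]
    refine mul_le_mul_of_nonneg_right ?_ hM0
    norm_cast
    refine Finset.card_le_card_of_injOn (fun k => ({y, k} : Finset V)) ?_ ?_
    · intro k hk
      simp only [coe_erase, Set.mem_diff, mem_coe, Set.mem_singleton_iff] at hk
      simp only [coe_filter, Set.mem_setOf_eq, mem_powersetCard]
      refine ⟨⟨?_, Finset.card_pair (Ne.symm hk.2)⟩, by simp⟩
      intro z hz
      simp only [mem_insert, mem_singleton] at hz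
      rcases hz with rfl | rfl
      · exact hy
      · exact hk.1
    · intro k hk l hl hkl
      simp only [coe_erase, Set.mem_diff, mem_coe, Set.mem_singleton_iff] at hk hl
      have : k ∈ ({y, l} : Finset V) := by
        have hkl' : ({y, k} : Finset V) = {y, l} := hkl
        rw [← hkl']; simp
      simp only [mem_insert, mem_singleton] at this
      exact this.resolve_left hk.2
  · rw [mul_zero]
    positivity

/-- Cleaning a good edge: if `e = {i,j}` is an edge of a spanning subgraph `H ≤ G`, is good
in `G`, and has Jaccard similarity at most `ε` in `H`, then the weight of the triangles of
`H` containing `e` is at most `(3ε/γ²)` times the weight of the wedges of `H` containing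
`e` (all weights computed from `G`). -/
theorem cleaning_good_edge {V : Type*} [Fintype V] [DecidableEq V]
    (G H : SimpleGraph V) (hHG : H ≤ G) (γ ε : ℝ) (hγ0 : 0 < γ) (hγ1 : γ ≤ 1)
    (i j : V) (hadj : H.Adj i j) (hgood : goodAdj G γ i j) (hclean : jac H i j ≤ ε) :
    ∑ t ∈ (H.cliqueFinset 3).filter (fun t => i ∈ t ∧ j ∈ t), triWeight G γ t ≤
      3 * ε / γ ^ 2 *
        (∑ p ∈ ((H.neighborFinset i).powersetCard 2).filter (fun p => j ∈ p),
            wedgeWeight G γ i p +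
          ∑ p ∈ ((H.neighborFinset j).powersetCard 2).filter (fun p => i ∈ p),
            wedgeWeight G γ j p) := by
  obtain ⟨ha, hb, hab, hba⟩ := good_bound G γ hγ0 i j hgood
  have hgood' : goodAdj G γ j i := by
    refine ⟨hgood.1.symm, hgood.2.trans_eq ?_⟩
    unfold jac
    rw [Finset.inter_comm, Finset.union_comm, Finset.pair_comm]
  obtain ⟨M, hM⟩ : ∃ M, M = max ((G.degree i : ℝ) - 1) ((G.degree j : ℝ) - 1) := ⟨_, rfl⟩
  have hMi : (G.degree i : ℝ) - 1 ≤ M := hM ▸ le_max_left _ _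
  have hMj : (G.degree j : ℝ) - 1 ≤ M := hM ▸ le_max_right _ _
  have hM0 : 0 < M := by linarith
  have hi : γ * M ≤ (G.degree i : ℝ) - 1 := by
    rcases max_cases ((G.degree i : ℝ) - 1) ((G.degree j : ℝ) - 1) with h | h <;>
      rw [hM, h.1] <;> nlinarith
  have hj : γ * M ≤ (G.degree j : ℝ) - 1 := by
    rcases max_cases ((G.degree i : ℝ) - 1) ((G.degree j : ℝ) - 1) with h | h <;>
      rw [hM, h.1] <;> nlinarith
  have hgM : γ ^ 2 * M ≤ γ * M := by nlinarith [mul_pos hγ0 hM0]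
  have hpos : 0 < γ ^ 2 * M := by positivity
  have hterm : ∀ t ∈ (H.cliqueFinset 3).filter (fun t => i ∈ t ∧ j ∈ t),
      triWeight G γ t ≤ 3 * (1 / (γ ^ 2 * M)) ∧
        ∃ k ∈ H.neighborFinset i ∩ H.neighborFinset j, ({i, j, k} : Finset V) = t := by
    intro t ht
    simp only [mem_filter, SimpleGraph.mem_cliqueFinset_iff] at ht
    obtain ⟨hcl, hit, hjt⟩ := ht
    have hne := hadj.ne
    have hk : ∃ k ∈ t, k ≠ i ∧ k ≠ j := by
      have : 0 < ((t.erase i).erase j).card := by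
        rw [Finset.card_erase_of_mem (by simp [hjt, hne.symm]), Finset.card_erase_of_mem hit,
          hcl.card_eq]
        norm_num
      obtain ⟨k, hk⟩ := Finset.card_pos.mp this
      simp only [mem_erase] at hk
      exact ⟨k, hk.2.2, hk.2.1, hk.1⟩
    obtain ⟨k, hkt, hki, hkj⟩ := hk
    have hteq : ({i, j, k} : Finset V) = t := by
      apply Finset.eq_of_subset_of_card_le
      · intro z hz
        simp only [mem_insert, mem_singleton] at hz
        rcases hz with rfl | rfl | rfl <;> assumption
      · rw [hcl.card_eq, Finset.card_eq_three.mpr ⟨i, j, k, hne, hki.symm, hkj.symm, rfl⟩]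
    refine ⟨?_, k, ?_, hteq⟩
    · have : triWeight G γ t ≤ t.card • (1 / (γ ^ 2 * M)) := by
        unfold triWeight
        apply Finset.sum_le_card_nsmul
        intro v hv
        split_ifs with hex
        · apply one_div_le_one_div_of_le hpos
          obtain ⟨u, hu, hvu⟩ := hex
          have hb' := good_bound G γ hγ0 v u hvu
          rw [← hteq] at hv hu
          simp only [mem_insert, mem_singleton] at hv hu
          rcases hv with rfl | rfl | rfl
          · linarith
          · linarith
          · rcases hu with rfl | rfl | rfl
            · nlinarith [hb'.2.2.2]
            · nlinarith [hb'.2.2.2]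
            · exact absurd hvu.1 (G.irrefl)
        · positivity
      rw [hcl.card_eq, nsmul_eq_mul] at this
      exact_mod_cast this
    · simp only [mem_inter, SimpleGraph.mem_neighborFinset]
      exact ⟨hcl.isClique hit hkt hki.symm, hcl.isClique hjt hkt hkj.symm⟩
  have hcard : ((H.cliqueFinset 3).filter (fun t => i ∈ t ∧ j ∈ t)).card ≤
      (H.neighborFinset i ∩ H.neighborFinset j).card := by
    refine le_trans (Finset.card_le_card ?_)
      (Finset.card_image_le (f := fun k => ({i, j, k} : Finset V)))
    intro t ht
    obtain ⟨k, hk, hkt⟩ := (hterm t ht).2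
    exact mem_image.mpr ⟨k, hk, hkt⟩
  have hL := Finset.sum_le_card_nsmul _ _ _ (fun t ht => (hterm t ht).1)
  rw [nsmul_eq_mul] at hL
  have hcard' : (((H.cliqueFinset 3).filter (fun t => i ∈ t ∧ j ∈ t)).card : ℝ) ≤
      ((H.neighborFinset i ∩ H.neighborFinset j).card : ℝ) := by exact_mod_cast hcard
  have hWi := wedge_sum G γ hγ0 i j hgood (H.neighborFinset i) M hMi
  have hWj := wedge_sum G γ hγ0 j i hgood' (H.neighborFinset j) M hMj
  rw [if_pos (by simpa using hadj), mul_one] at hWi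
  rw [if_pos (by simpa using hadj.symm), mul_one] at hWj
  have hsub : (H.neighborFinset i ∩ H.neighborFinset j).card ≤
      ((H.neighborFinset i ∪ H.neighborFinset j) \ {i, j}).card := by
    apply Finset.card_le_card
    intro k hk
    simp only [mem_sdiff, mem_union, mem_inter, mem_insert, mem_singleton,
      SimpleGraph.mem_neighborFinset] at hk ⊢
    have := hk.1.ne'
    have := hk.2.ne'
    tauto
  have hU : ((H.neighborFinset i ∪ H.neighborFinset j) \ {i, j}).card ≤
      ((H.neighborFinset i).erase j).card + ((H.neighborFinset j).erase i).card := by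
    refine le_trans (Finset.card_le_card ?_) (Finset.card_union_le _ _)
    intro k hk
    simp only [mem_sdiff, mem_union, mem_insert, mem_singleton, mem_erase,
      SimpleGraph.mem_neighborFinset] at hk ⊢
    tauto
  have hU' : (((H.neighborFinset i ∪ H.neighborFinset j) \ {i, j}).card : ℝ) ≤
      (((H.neighborFinset i).erase j).card : ℝ) + ((H.neighborFinset j).erase i).card := by
    exact_mod_cast hU
  have hε : 0 ≤ ε := le_trans (by unfold jac; positivity) hclean
  have ht : ((H.neighborFinset i ∩ H.neighborFinset j).card : ℝ) ≤
      ε * ((H.neighborFinset i ∪ H.neighborFinset j) \ {i, j}).card := by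
    unfold jac at hclean
    rcases Nat.eq_zero_or_pos ((H.neighborFinset i ∪ H.neighborFinset j) \ {i, j}).card with h0 | h0
    · have : (H.neighborFinset i ∩ H.neighborFinset j).card = 0 := by omega
      rw [this, h0]; simp
    · rwa [div_le_iff₀ (by exact_mod_cast h0)] at hclean
  calc _ ≤ _ := hL
    _ ≤ (ε * ((((H.neighborFinset i).erase j).card : ℝ) + ((H.neighborFinset j).erase i).card)) *
        (3 * (1 / (γ ^ 2 * M))) := by
      refine mul_le_mul_of_nonneg_right ?_ (by positivity)
      exact hcard'.trans (ht.trans (mul_le_mul_of_nonneg_left hU' hε))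
    _ = 3 * ε / γ ^ 2 * ((((H.neighborFinset i).erase j).card : ℝ) * (1 / M) +
        (((H.neighborFinset j).erase i).card : ℝ) * (1 / M)) := by
      field_simp
    _ ≤ _ := by
      refine mul_le_mul_of_nonneg_left (add_le_add hWi hWj) (by positivity)
end

section
/- (Cleaning a bad edge) Let G be a finite simple graph and γ ∈ (0,1]. For every bad edge e = {i,j} of G, the total weight of the triangles of G containing e satisfies r(T_e) ≤ 4/γ, where T_e is the set of triangles of G containing e and weights are computed from the degrees and good edges of G. -/
open scoped Classical
open Finset

lemma card_inter_le_deg {V : Type*} [Fintype V] [DecidableEq V] (G : SimpleGraph V)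
    (u v : V) (h : G.Adj v u) :
    ((G.neighborFinset v ∩ G.neighborFinset u).card : ℝ) ≤ (G.degree v : ℝ) - 1 := by
  have hm : u ∈ G.neighborFinset v := by simpa using h
  have h1 : G.neighborFinset v ∩ G.neighborFinset u ⊆ (G.neighborFinset v).erase u := by
    intro x hx
    simp only [Finset.mem_inter, SimpleGraph.mem_neighborFinset, Finset.mem_erase] at hx ⊢
    exact ⟨hx.2.ne', hx.1⟩
  have h2 := Finset.card_le_card h1
  have h3 := Finset.card_erase_add_one hm
  rw [SimpleGraph.card_neighborFinset_eq_degree] at h3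
  have h4 : (G.neighborFinset v ∩ G.neighborFinset u).card + 1 ≤ G.degree v := by omega
  have h5 : ((G.neighborFinset v ∩ G.neighborFinset u).card : ℝ) + 1 ≤ G.degree v := by
    exact_mod_cast h4
  linarith

lemma goodAdj_deg {V : Type*} [Fintype V] [DecidableEq V] (G : SimpleGraph V) (γ : ℝ)
    (hγ0 : 0 < γ) (u v : V) (h : goodAdj G γ v u) :
    γ * ((G.degree u : ℝ) - 1) ≤ (G.degree v : ℝ) - 1 := by
  obtain ⟨ha, hj⟩ := h
  refine le_trans ?_ (card_inter_le_deg G u v ha)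
  unfold jac at hj
  have hm : v ∈ G.neighborFinset u := by simpa using ha.symm
  have h1 : (G.neighborFinset u).erase v ⊆
      (G.neighborFinset v ∪ G.neighborFinset u) \ {v, u} := by
    intro x hx
    simp only [Finset.mem_erase, SimpleGraph.mem_neighborFinset, Finset.mem_sdiff,
      Finset.mem_union, Finset.mem_insert, Finset.mem_singleton] at hx ⊢
    refine ⟨Or.inr hx.2, ?_⟩
    rintro (h | h)
    · exact hx.1 h
    · exact hx.2.ne' h
  have h2 := Finset.card_le_card h1
  have h3 := Finset.card_erase_add_one hm
  rw [SimpleGraph.card_neighborFinset_eq_degree] at h3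
  have h4 : G.degree u ≤ ((G.neighborFinset v ∪ G.neighborFinset u) \ {v, u}).card + 1 := by
    omega
  have h5 : (G.degree u : ℝ) ≤
      (((G.neighborFinset v ∪ G.neighborFinset u) \ {v, u}).card : ℝ) + 1 := by
    exact_mod_cast h4
  rcases (Nat.cast_nonneg (α := ℝ)
    ((G.neighborFinset v ∪ G.neighborFinset u) \ {v, u}).card).eq_or_lt with h0 | h0
  · rw [← h0, div_zero] at hj
    linarith
  · rw [le_div_iff₀ h0] at hj
    refine le_trans ?_ hj
    exact mul_le_mul_of_nonneg_left (by linarith) hγ0.le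

lemma inv_deg_le {γ a b : ℝ} (hγ0 : 0 < γ) (ha : 0 < a) (h : γ * a ≤ b) :
    1 / b ≤ 1 / γ * (1 / a) := by
  rw [one_div_mul_one_div]
  exact one_div_le_one_div_of_le (by positivity) h

lemma triWeight_le {V : Type*} [Fintype V] [DecidableEq V] (G : SimpleGraph V)
    (γ : ℝ) (hγ0 : 0 < γ) (hγ1 : γ ≤ 1) (i j k : V) (hij : G.Adj i j)
    (hik : G.Adj i k) (hjk : G.Adj j k)
    (hi : 0 < (G.degree i : ℝ) - 1) (hj : 0 < (G.degree j : ℝ) - 1) :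
    triWeight G γ {i, j, k} ≤
      2 / γ * (1 / ((G.degree i : ℝ) - 1) + 1 / ((G.degree j : ℝ) - 1)) := by
  have hi' : 0 < 1 / ((G.degree i : ℝ) - 1) := by positivity
  have hj' : 0 < 1 / ((G.degree j : ℝ) - 1) := by positivity
  have hg : 1 ≤ 1 / γ := by rw [le_div_iff₀ hγ0]; linarith
  have e : 2 / γ = 2 * (1 / γ) := by ring
  unfold triWeight
  rw [Finset.sum_insert (by simp [hij.ne, hik.ne]), Finset.sum_insert (by simp [hjk.ne]),
    Finset.sum_singleton, e]
  set A := 1 / ((G.degree i : ℝ) - 1) with hA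
  set B := 1 / ((G.degree j : ℝ) - 1) with hB
  have hgA : A ≤ 1 / γ * A := le_mul_of_one_le_left hi'.le hg
  have hgB : B ≤ 1 / γ * B := le_mul_of_one_le_left hj'.le hg
  have t1 : ∀ (p : Prop) [Decidable p], (if p then A else 0) ≤ A := by
    intro p _; split_ifs <;> linarith
  have t2 : ∀ (p : Prop) [Decidable p], (if p then B else 0) ≤ B := by
    intro p _; split_ifs <;> linarith
  have t3 : (if ∃ u ∈ ({i, j, k} : Finset V), goodAdj G γ k u
      then 1 / ((G.degree k : ℝ) - 1) else 0) ≤ 1 / γ * A + 1 / γ * B := by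
    split_ifs with h
    · obtain ⟨u, hu, hgood⟩ := h
      simp only [Finset.mem_insert, Finset.mem_singleton] at hu
      rcases hu with rfl | rfl | rfl
      · have := inv_deg_le hγ0 hi (goodAdj_deg G γ hγ0 _ _ hgood)
        linarith
      · have := inv_deg_le hγ0 hj (goodAdj_deg G γ hγ0 _ _ hgood)
        linarith
      · exact absurd hgood.1 (G.irrefl)
    · linarith
  have := t1 (∃ u ∈ ({i, j, k} : Finset V), goodAdj G γ i u)
  have := t2 (∃ u ∈ ({i, j, k} : Finset V), goodAdj G γ j u)
  linarith

lemma tri_subset {V : Type*} [Fintype V] [DecidableEq V]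
    (G : SimpleGraph V) (i j : V) (hadj : G.Adj i j) (t : Finset V)
    (ht : t ∈ (G.cliqueFinset 3).filter (fun t => i ∈ t ∧ j ∈ t)) :
    ∃ k, G.Adj i k ∧ G.Adj j k ∧ t = {i, j, k} := by
  simp only [Finset.mem_filter, SimpleGraph.mem_cliqueFinset_iff] at ht
  obtain ⟨hc, hi, hj⟩ := ht
  rw [SimpleGraph.is3Clique_iff] at hc
  obtain ⟨a, b, c, hab, hac, hbc, rfl⟩ := hc
  have hne := hadj.ne
  simp only [Finset.mem_insert, Finset.mem_singleton] at hi hj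
  rcases hi with rfl | rfl | rfl <;> rcases hj with rfl | rfl | rfl
  · exact absurd rfl hne
  · exact ⟨c, hac, hbc, rfl⟩
  · exact ⟨b, hab, hbc.symm, by ext; simp; tauto⟩
  · exact ⟨c, hbc, hac, by ext; simp; tauto⟩
  · exact absurd rfl hne
  · exact ⟨a, hab.symm, hac.symm, by ext; simp; tauto⟩
  · exact ⟨b, hbc.symm, hab, by ext; simp; tauto⟩
  · exact ⟨a, hac.symm, hab.symm, by ext; simp; tauto⟩
  · exact absurd rfl hne

/-- Cleaning a bad edge: for every bad edge `e = {i,j}` of `G` (Jaccard similarity less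
than `γ`), the total weight of triangles of `G` containing `e` is at most `4/γ`. -/
theorem cleaning_bad_edge {V : Type*} [Fintype V] [DecidableEq V]
    (G : SimpleGraph V) (γ : ℝ) (hγ0 : 0 < γ) (hγ1 : γ ≤ 1)
    (i j : V) (hadj : G.Adj i j) (hbad : jac G i j < γ) :
    ∑ t ∈ (G.cliqueFinset 3).filter (fun t => i ∈ t ∧ j ∈ t), triWeight G γ t ≤ 4 / γ := by
  set T := (G.cliqueFinset 3).filter (fun t => i ∈ t ∧ j ∈ t) with hT
  have hcard : T.card ≤ (G.neighborFinset i ∩ G.neighborFinset j).card := by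
    refine le_trans (Finset.card_le_card
      (t := (G.neighborFinset i ∩ G.neighborFinset j).image (fun k => {i, j, k})) ?_)
      Finset.card_image_le
    intro t ht
    obtain ⟨k, h1, h2, rfl⟩ := tri_subset G i j hadj t ht
    exact Finset.mem_image.2 ⟨k, by simp [h1, h2], rfl⟩
  have hcR : (T.card : ℝ) ≤ ((G.neighborFinset i ∩ G.neighborFinset j).card : ℝ) := by
    exact_mod_cast hcard
  have hci := hcR.trans (card_inter_le_deg G j i hadj)
  have hcj : (T.card : ℝ) ≤ (G.degree j : ℝ) - 1 := by
    rw [Finset.inter_comm] at hcR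
    exact hcR.trans (card_inter_le_deg G i j hadj.symm)
  rcases T.eq_empty_or_nonempty with h0 | h0
  · rw [h0, Finset.sum_empty]
    positivity
  have hpos : (0 : ℝ) < T.card := by exact_mod_cast h0.card_pos
  have hi : 0 < (G.degree i : ℝ) - 1 := by linarith
  have hj : 0 < (G.degree j : ℝ) - 1 := by linarith
  have hs := Finset.sum_le_card_nsmul T (triWeight G γ)
    (2 / γ * (1 / ((G.degree i : ℝ) - 1) + 1 / ((G.degree j : ℝ) - 1))) (by
      intro t ht
      obtain ⟨k, h1, h2, rfl⟩ := tri_subset G i j hadj t ht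
      exact triWeight_le G γ hγ0 hγ1 i j k hadj h1 h2 hi hj)
  refine hs.trans ?_
  rw [nsmul_eq_mul]
  have hA : (T.card : ℝ) / ((G.degree i : ℝ) - 1) ≤ 1 := (div_le_one hi).2 hci
  have hB : (T.card : ℝ) / ((G.degree j : ℝ) - 1) ≤ 1 := (div_le_one hj).2 hcj
  have hg : 0 ≤ 2 / γ := by positivity
  calc (T.card : ℝ) * (2 / γ * (1 / ((G.degree i : ℝ) - 1) + 1 / ((G.degree j : ℝ) - 1)))
      = 2 / γ * ((T.card : ℝ) / ((G.degree i : ℝ) - 1)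
          + (T.card : ℝ) / ((G.degree j : ℝ) - 1)) := by ring
    _ ≤ 2 / γ * 2 := mul_le_mul_of_nonneg_left (by linarith) hg
    _ = 4 / γ := by ring
end

section
/- (Surviving triangle weight) Let G be a finite simple graph, γ ∈ (0,1], μ ≥ 1 − γ²/32, and 0 < ε ≤ γ³/12. Assume at least a μ fraction of the edges of G are good. Let G = G_0, G_1, …, G_m be a sequence of spanning subgraphs where each G_l is obtained from G_{l−1} by deleting one edge whose Jaccard similarity in G_{l−1} is at most ε. Then the set T^s of triangles of the final graph G_m satisfies r(T^s) ≥ γ·|E(G)|/4, where weights r are computed from the degrees and good edges of the original graph G. -/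
open scoped Classical
open Finset

section helpers
variable {V : Type*} [Fintype V] [DecidableEq V]

theorem aux_jac_symm (G : SimpleGraph V) (i j : V) : jac G i j = jac G j i := by
  unfold jac
  rw [Finset.inter_comm, Finset.union_comm, Finset.pair_comm]

theorem aux_good_symm {G : SimpleGraph V} {γ : ℝ} {i j : V} (h : goodAdj G γ i j) :
    goodAdj G γ j i := ⟨h.1.symm, by rw [aux_jac_symm]; exact h.2⟩

/-- common neighbours are at most `d_i - 1` when adjacent -/
theorem aux_inter_le (G : SimpleGraph V) {i j : V} (h : G.Adj i j) :
    ((G.neighborFinset i ∩ G.neighborFinset j).card : ℝ) ≤ (G.degree i : ℝ) - 1 := by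
  have h1 : (G.neighborFinset i ∩ G.neighborFinset j) ⊆ (G.neighborFinset i).erase j := by
    intro k hk
    simp only [Finset.mem_inter, SimpleGraph.mem_neighborFinset, Finset.mem_erase] at hk ⊢
    exact ⟨fun e => (G.ne_of_adj hk.2) e.symm, hk.1⟩
  have h2 := Finset.card_le_card h1
  have h3 : j ∈ G.neighborFinset i := by simpa using h
  rw [Finset.card_erase_of_mem h3, SimpleGraph.card_neighborFinset_eq_degree] at h2
  have h4 : 0 < G.degree i := (G.degree_pos_iff_exists_adj i).2 ⟨j, h⟩
  have h5 : (G.neighborFinset i ∩ G.neighborFinset j).card + 1 ≤ G.degree i := by omega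
  have : (((G.neighborFinset i ∩ G.neighborFinset j).card + 1 : ℕ) : ℝ) ≤ G.degree i := by
    exact_mod_cast h5
  push_cast at this
  linarith

theorem aux_le_union (G : SimpleGraph V) {i j : V} (h : G.Adj i j) :
    (G.degree i : ℝ) - 1 ≤ (((G.neighborFinset i ∪ G.neighborFinset j) \ {i, j}).card : ℝ) := by
  have h1 : (G.neighborFinset i).erase j ⊆ (G.neighborFinset i ∪ G.neighborFinset j) \ {i, j} := by
    intro k hk
    simp only [Finset.mem_erase, SimpleGraph.mem_neighborFinset, Finset.mem_sdiff,
      Finset.mem_union, Finset.mem_insert, Finset.mem_singleton, not_or] at hk ⊢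
    exact ⟨Or.inl hk.2, fun e => (G.ne_of_adj hk.2) e.symm, hk.1⟩
  have h2 := Finset.card_le_card h1
  have h3 : j ∈ G.neighborFinset i := by simpa using h
  rw [Finset.card_erase_of_mem h3, SimpleGraph.card_neighborFinset_eq_degree] at h2
  have h5 : G.degree i ≤ ((G.neighborFinset i ∪ G.neighborFinset j) \ {i, j}).card + 1 := by omega
  have : (G.degree i : ℝ) ≤ ((((G.neighborFinset i ∪ G.neighborFinset j) \ {i, j}).card + 1 : ℕ) : ℝ) := by
    exact_mod_cast h5
  push_cast at this
  linarith

/-- for a good edge: the union is nonempty and `γ |U| ≤ |I|`. -/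
theorem aux_good {G : SimpleGraph V} {γ : ℝ} (hγ0 : 0 < γ) {i j : V} (h : goodAdj G γ i j) :
    0 < (((G.neighborFinset i ∪ G.neighborFinset j) \ {i, j}).card : ℝ) ∧
    γ * (((G.neighborFinset i ∪ G.neighborFinset j) \ {i, j}).card : ℝ) ≤
      ((G.neighborFinset i ∩ G.neighborFinset j).card : ℝ) := by
  have h2 := h.2
  unfold jac at h2
  have hpos : 0 < (((G.neighborFinset i ∪ G.neighborFinset j) \ {i, j}).card : ℝ) := by
    rcases (Nat.cast_nonneg (α := ℝ)
      ((G.neighborFinset i ∪ G.neighborFinset j) \ {i, j}).card).lt_or_eq with h | h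
    · exact h
    · rw [← h, div_zero] at h2; linarith
  exact ⟨hpos, (le_div_iff₀ hpos).1 h2⟩

theorem aux_good_deg {G : SimpleGraph V} {γ : ℝ} (hγ0 : 0 < γ) {i j : V} (h : goodAdj G γ i j) :
    γ * ((G.degree i : ℝ) - 1) ≤ (G.degree j : ℝ) - 1 ∧ 0 < (G.degree i : ℝ) - 1 := by
  obtain ⟨hp, hle⟩ := aux_good hγ0 h
  have h1 := aux_le_union G h.1
  have h2 := aux_inter_le G h.1
  have h3 := aux_inter_le G h.1.symm
  rw [Finset.inter_comm] at h3
  have := mul_le_mul_of_nonneg_left h1 hγ0.le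
  have := mul_pos hγ0 hp
  constructor <;> linarith

theorem aux_term_nonneg (G : SimpleGraph V) {γ : ℝ} (hγ0 : 0 < γ) (t : Finset V) (v : V) :
    0 ≤ (if ∃ u ∈ t, goodAdj G γ v u then 1 / ((G.degree v : ℝ) - 1) else 0) := by
  split_ifs with h
  · obtain ⟨u, _, hu⟩ := h
    have := (aux_good_deg hγ0 hu).2
    positivity
  · exact le_rfl

theorem aux_tri_nonneg (G : SimpleGraph V) {γ : ℝ} (hγ0 : 0 < γ) (t : Finset V) :
    0 ≤ triWeight G γ t :=
  Finset.sum_nonneg fun v _ => aux_term_nonneg G hγ0 t v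

theorem aux_tri_eq (G : SimpleGraph V) (γ : ℝ) {i j k : V} (hij : i ≠ j) (hik : i ≠ k)
    (hjk : j ≠ k) : triWeight G γ {i, j, k} =
      (if goodAdj G γ i j ∨ goodAdj G γ i k then 1 / ((G.degree i : ℝ) - 1) else 0) +
      (if goodAdj G γ i j ∨ goodAdj G γ j k then 1 / ((G.degree j : ℝ) - 1) else 0) +
      (if goodAdj G γ i k ∨ goodAdj G γ j k then 1 / ((G.degree k : ℝ) - 1) else 0) := by
  have hs : ∀ a b, goodAdj G γ a b ↔ goodAdj G γ b a :=
    fun a b => ⟨aux_good_symm, aux_good_symm⟩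
  have hn : ∀ a, ¬ goodAdj G γ a a := fun a h => G.loopless.irrefl a h.1
  unfold triWeight
  rw [Finset.sum_insert (by simp [hij, hik]), Finset.sum_insert (by simp [hjk]),
    Finset.sum_singleton]
  simp only [Finset.mem_insert, Finset.mem_singleton, exists_eq_or_imp, exists_eq_left, hn,
    false_or, or_false, hs j i, hs k i, hs k j]
  ring

theorem aux_tri_inj {i j : V} (s : Finset V) (hi : i ∉ s) (hj : j ∉ s) :
    Set.InjOn (fun k => ({i, j, k} : Finset V)) (s : Set V) := by
  intro a ha b hb hab
  have : a ∈ ({i, j, b} : Finset V) := by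
    rw [← show ({i, j, a} : Finset V) = {i, j, b} from hab]; simp
  simp only [Finset.mem_insert, Finset.mem_singleton] at this
  rcases this with h | h | h
  · exact absurd (h ▸ ha) hi
  · exact absurd (h ▸ ha) hj
  · exact h

noncomputable def auxW (G : SimpleGraph V) (γ : ℝ) (H : SimpleGraph V) : ℝ :=
  ∑ t ∈ H.cliqueFinset 3, triWeight G γ t

theorem aux_sum_cover {α : Type*} (A B C : Finset α) (f : α → ℝ) (hf : ∀ x, 0 ≤ f x)
    (h : ∀ x ∈ A, x ∈ B ∨ x ∈ C) : ∑ x ∈ A, f x ≤ ∑ x ∈ B, f x + ∑ x ∈ C, f x := by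
  rw [← Finset.sum_union_inter]
  have h1 : ∑ x ∈ A, f x ≤ ∑ x ∈ B ∪ C, f x :=
    Finset.sum_le_sum_of_subset_of_nonneg (fun x hx => Finset.mem_union.2 (h x hx))
      (fun x _ _ => hf x)
  have h2 : 0 ≤ ∑ x ∈ B ∩ C, f x := Finset.sum_nonneg fun x _ => hf x
  linarith

theorem aux_W_step (G H H' : SimpleGraph V) {γ : ℝ} (hγ0 : 0 < γ) {i j : V}
    (hH : H' = H.deleteEdges {s(i, j)}) :
    auxW G γ H ≤ auxW G γ H' +
      ∑ k ∈ H.neighborFinset i ∩ H.neighborFinset j, triWeight G γ {i, j, k} := by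
  have hsub : ∀ t ∈ H.cliqueFinset 3, t ∈ H'.cliqueFinset 3 ∨
      t ∈ (H.neighborFinset i ∩ H.neighborFinset j).image (fun k => ({i, j, k} : Finset V)) := by
    intro t ht
    rw [SimpleGraph.mem_cliqueFinset_iff] at ht
    by_cases hm : i ∈ t ∧ j ∈ t ∧ i ≠ j
    · right
      obtain ⟨hi, hj, hij⟩ := hm
      have hc : ((t.erase i).erase j).card = 1 := by
        rw [Finset.card_erase_of_mem (by simp [hj, hij.symm]), Finset.card_erase_of_mem hi,
          ht.card_eq]
      obtain ⟨k, hk⟩ := Finset.card_eq_one.1 hc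
      have hkt : k ∈ (t.erase i).erase j := by rw [hk]; simp
      simp only [Finset.mem_erase] at hkt
      rw [Finset.mem_image]
      refine ⟨k, ?_, ?_⟩
      · simp only [Finset.mem_inter, SimpleGraph.mem_neighborFinset]
        exact ⟨ht.isClique hi hkt.2.2 (Ne.symm hkt.2.1), ht.isClique hj hkt.2.2 (Ne.symm hkt.1)⟩
      · rw [← hk, Finset.insert_erase (by simp [hj, hij.symm]), Finset.insert_erase hi]
    · left
      rw [SimpleGraph.mem_cliqueFinset_iff]
      refine ⟨?_, ht.card_eq⟩
      intro a ha b hb hab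
      rw [hH, SimpleGraph.deleteEdges_adj]
      refine ⟨ht.isClique ha hb hab, ?_⟩
      intro he
      rw [Set.mem_singleton_iff, Sym2.eq_iff] at he
      apply hm
      rcases he with ⟨rfl, rfl⟩ | ⟨rfl, rfl⟩
      · exact ⟨ha, hb, hab⟩
      · exact ⟨hb, ha, hab.symm⟩
  unfold auxW
  have hui := aux_sum_cover _ _ _ (fun t => triWeight G γ t)
    (fun t => aux_tri_nonneg G hγ0 t) hsub
  rw [Finset.sum_image (aux_tri_inj _ (by simp) (by simp))] at hui
  exact hui

theorem aux_card_common_le {G H : SimpleGraph V} (hle : H ≤ G) (i j : V) :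
    (((H.neighborFinset i ∩ H.neighborFinset j).card : ℕ) : ℝ) ≤
      ((G.neighborFinset i ∩ G.neighborFinset j).card : ℝ) := by
  have : H.neighborFinset i ∩ H.neighborFinset j ⊆ G.neighborFinset i ∩ G.neighborFinset j := by
    intro k hk
    simp only [Finset.mem_inter, SimpleGraph.mem_neighborFinset] at hk ⊢
    exact ⟨hle hk.1, hle hk.2⟩
  exact_mod_cast Finset.card_le_card this

theorem aux_inv_bound {γ a b : ℝ} (hγ0 : 0 < γ) (ha : 0 < a) (h : γ * a ≤ b) :
    1 / b ≤ 1 / (γ * a) := one_div_le_one_div_of_le (mul_pos hγ0 ha) h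

theorem aux_bad_step {G H : SimpleGraph V} {γ : ℝ} (hγ0 : 0 < γ) (hγ1 : γ ≤ 1) (hle : H ≤ G)
    {i j : V} (hadj : H.Adj i j) (hb : ¬ goodAdj G γ i j) :
    ∑ k ∈ H.neighborFinset i ∩ H.neighborFinset j, triWeight G γ {i, j, k} ≤ 4 / γ := by
  have hG := hle hadj
  set N := H.neighborFinset i ∩ H.neighborFinset j with hN
  have hNi : (N.card : ℝ) ≤ (G.degree i : ℝ) - 1 :=
    (aux_card_common_le hle i j).trans (aux_inter_le G hG)
  have hNj : (N.card : ℝ) ≤ (G.degree j : ℝ) - 1 := by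
    refine (aux_card_common_le hle i j).trans ?_
    rw [Finset.inter_comm]; exact aux_inter_le G hG.symm
  by_cases h0 : N.card = 0
  · rw [Finset.card_eq_zero.1 h0, Finset.sum_empty]; positivity
  have hNpos : (0 : ℝ) < N.card := by exact_mod_cast Nat.pos_of_ne_zero h0
  set x := (G.degree i : ℝ) - 1 with hx
  set y := (G.degree j : ℝ) - 1 with hy
  have hxp : 0 < x := by linarith
  have hyp : 0 < y := by linarith
  have hterm : ∀ k ∈ N, triWeight G γ {i, j, k} ≤ 2 / (γ * x) + 2 / (γ * y) := by
    intro k hk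
    simp only [hN, Finset.mem_inter, SimpleGraph.mem_neighborFinset] at hk
    rw [aux_tri_eq G γ hadj.ne hk.1.ne hk.2.ne]
    have e1 : 1 / x ≤ 1 / (γ * x) :=
      one_div_le_one_div_of_le (by positivity) (by nlinarith)
    have e2 : 1 / y ≤ 1 / (γ * y) :=
      one_div_le_one_div_of_le (by positivity) (by nlinarith)
    have e3 : 0 < 1 / (γ * x) := by positivity
    have e4 : 0 < 1 / (γ * y) := by positivity
    have t1 : 2 / (γ * x) = 1 / (γ * x) + 1 / (γ * x) := by ring
    have t2 : 2 / (γ * y) = 1 / (γ * y) + 1 / (γ * y) := by ring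
    rw [t1, t2]
    simp only [hb, false_or]
    by_cases g1 : goodAdj G γ i k
    · have := aux_inv_bound hγ0 hxp (aux_good_deg hγ0 g1).1
      by_cases g2 : goodAdj G γ j k
      · simp only [g1, g2, or_self, if_true]; linarith
      · simp only [g1, g2, true_or, if_true, if_false]; linarith
    · by_cases g2 : goodAdj G γ j k
      · have := aux_inv_bound hγ0 hyp (aux_good_deg hγ0 g2).1
        simp only [g1, g2, or_true, if_true, if_false]; linarith
      · simp only [g1, g2, or_self, if_false]; linarith
  refine (Finset.sum_le_card_nsmul _ _ _ hterm).trans ?_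
  rw [nsmul_eq_mul, mul_add]
  have a1 : (N.card : ℝ) * (2 / (γ * x)) ≤ 2 / γ := by
    calc (N.card : ℝ) * (2 / (γ * x)) ≤ x * (2 / (γ * x)) := by gcongr
      _ = 2 / γ := by field_simp
  have a2 : (N.card : ℝ) * (2 / (γ * y)) ≤ 2 / γ := by
    calc (N.card : ℝ) * (2 / (γ * y)) ≤ y * (2 / (γ * y)) := by gcongr
      _ = 2 / γ := by field_simp
  have : 4 / γ = 2 / γ + 2 / γ := by ring
  linarith

theorem aux_good_step {G H : SimpleGraph V} {γ ε : ℝ} (hγ0 : 0 < γ) (hγ1 : γ ≤ 1)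
    (hε0 : 0 < ε) (hε1 : ε ≤ γ ^ 3 / 12) (hle : H ≤ G)
    {i j : V} (hadj : H.Adj i j) (hjac : jac H i j ≤ ε) (hb : goodAdj G γ i j) :
    ∑ k ∈ H.neighborFinset i ∩ H.neighborFinset j, triWeight G γ {i, j, k} ≤ γ / 4 := by
  obtain ⟨hU, hUI⟩ := aux_good hγ0 hb
  have hi := aux_inter_le G hb.1
  have hj := aux_inter_le G hb.1.symm
  rw [Finset.inter_comm] at hj
  set U := (((G.neighborFinset i ∪ G.neighborFinset j) \ {i, j}).card : ℝ) with hUdef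
  set N := H.neighborFinset i ∩ H.neighborFinset j with hN
  have hUH : (((H.neighborFinset i ∪ H.neighborFinset j) \ {i, j}).card : ℝ) ≤ U := by
    have : (H.neighborFinset i ∪ H.neighborFinset j) \ {i, j} ⊆
        (G.neighborFinset i ∪ G.neighborFinset j) \ {i, j} := by
      intro k hk
      simp only [Finset.mem_sdiff, Finset.mem_union, SimpleGraph.mem_neighborFinset] at hk ⊢
      exact ⟨hk.1.imp (fun h => hle h) (fun h => hle h), hk.2⟩
    rw [hUdef]
    exact_mod_cast Finset.card_le_card this
  have hNU : (N.card : ℝ) ≤ ε * U := by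
    unfold jac at hjac
    rcases (Nat.cast_nonneg (α := ℝ)
      ((H.neighborFinset i ∪ H.neighborFinset j) \ {i, j}).card).lt_or_eq with h | h
    · rw [div_le_iff₀ h] at hjac
      exact hjac.trans (by gcongr)
    · have h1 := aux_le_union H hadj
      have h2 := aux_inter_le H hadj
      rw [← h] at h1
      have := mul_pos hε0 hU
      linarith
  set x := (G.degree i : ℝ) - 1 with hx
  set y := (G.degree j : ℝ) - 1 with hy
  have hgU : 0 < γ * U := by positivity
  have hterm : ∀ k ∈ N, triWeight G γ {i, j, k} ≤ 3 / (γ ^ 2 * U) := by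
    intro k hk
    simp only [hN, Finset.mem_inter, SimpleGraph.mem_neighborFinset] at hk
    rw [aux_tri_eq G γ hadj.ne hk.1.ne hk.2.ne]
    have hp : 0 < 1 / (γ ^ 2 * U) := by positivity
    have hcmp : γ ^ 2 * U ≤ γ * U := by nlinarith
    have e1 : 1 / x ≤ 1 / (γ ^ 2 * U) :=
      one_div_le_one_div_of_le (by positivity) (by linarith)
    have e2 : 1 / y ≤ 1 / (γ ^ 2 * U) :=
      one_div_le_one_div_of_le (by positivity) (by linarith)
    have e3 : (if goodAdj G γ i k ∨ goodAdj G γ j k then 1 / ((G.degree k : ℝ) - 1) else 0) ≤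
        1 / (γ ^ 2 * U) := by
      split_ifs with h
      · apply one_div_le_one_div_of_le (by positivity)
        rcases h with h | h
        · have := (aux_good_deg hγ0 h).1
          have := mul_le_mul_of_nonneg_left (hUI.trans hi) hγ0.le
          nlinarith
        · have := (aux_good_deg hγ0 h).1
          have := mul_le_mul_of_nonneg_left (hUI.trans hj) hγ0.le
          nlinarith
      · exact hp.le
    have t : 3 / (γ ^ 2 * U) = 1 / (γ ^ 2 * U) + 1 / (γ ^ 2 * U) + 1 / (γ ^ 2 * U) := by ring
    rw [t]
    simp only [hb, true_or, if_true]
    linarith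
  refine (Finset.sum_le_card_nsmul _ _ _ hterm).trans ?_
  rw [nsmul_eq_mul]
  calc (N.card : ℝ) * (3 / (γ ^ 2 * U)) ≤ (γ ^ 3 / 12 * U) * (3 / (γ ^ 2 * U)) := by
        gcongr
        exact hNU.trans (by gcongr)
    _ = γ / 4 := by field_simp; norm_num

/-- the graph of good edges -/
def auxGood (G : SimpleGraph V) (γ : ℝ) : SimpleGraph V where
  Adj := goodAdj G γ
  symm := ⟨fun _ _ h => aux_good_symm h⟩
  loopless := ⟨fun a h => G.loopless.irrefl a h.1⟩

theorem aux_lower (G : SimpleGraph V) {γ : ℝ} (hγ0 : 0 < γ) :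
    γ * ((auxGood G γ).edgeFinset.card : ℝ) ≤ auxW G γ G := by
  let f : V → V → ℝ := fun v u => if goodAdj G γ v u then 1 / ((G.degree v : ℝ) - 1) else 0
  have hf0 : ∀ v u, 0 ≤ f v u := by
    intro v u
    simp only [f]
    split_ifs with h
    · have := (aux_good_deg hγ0 h).2
      positivity
    · exact le_rfl
  -- each triangle
  have h1 : ∀ t ∈ G.cliqueFinset 3, ∑ v ∈ t, ∑ u ∈ t, f v u ≤ 2 * triWeight G γ t := by
    intro t ht
    rw [SimpleGraph.mem_cliqueFinset_iff] at ht
    unfold triWeight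
    rw [Finset.mul_sum]
    apply Finset.sum_le_sum
    intro v hv
    split_ifs with h
    · obtain ⟨u, _, hu⟩ := h
      have hd := (aux_good_deg hγ0 hu).2
      have hfv : f v v = 0 := by
        simp only [f]
        rw [if_neg]
        exact fun h => G.loopless.irrefl v h.1
      rw [← Finset.sum_erase t hfv]
      have hb : ∀ w ∈ t.erase v, f v w ≤ 1 / ((G.degree v : ℝ) - 1) := by
        intro w _
        simp only [f]
        split_ifs
        · exact le_rfl
        · positivity
      have := Finset.sum_le_card_nsmul _ _ _ hb
      rw [Finset.card_erase_of_mem hv, ht.card_eq, nsmul_eq_mul] at this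
      simpa using this
    · push Not at h
      rw [Finset.sum_eq_zero]
      · simp
      · intro u hu
        simp only [f]
        rw [if_neg (h u hu)]
  have h2 : ∑ t ∈ G.cliqueFinset 3, ∑ v ∈ t, ∑ u ∈ t, f v u ≤ 2 * auxW G γ G := by
    unfold auxW
    rw [Finset.mul_sum]
    exact Finset.sum_le_sum h1
  have h3 : ∑ t ∈ G.cliqueFinset 3, ∑ v ∈ t, ∑ u ∈ t, f v u =
      ∑ v, ∑ u, ∑ t ∈ G.cliqueFinset 3, if v ∈ t ∧ u ∈ t then f v u else 0 := by
    have : ∀ t ∈ G.cliqueFinset 3, ∑ v ∈ t, ∑ u ∈ t, f v u =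
        ∑ v, ∑ u, if v ∈ t ∧ u ∈ t then f v u else 0 := by
      intro t _
      rw [← Finset.sum_filter_add_sum_filter_not Finset.univ (fun v => v ∈ t)]
      simp only [Finset.filter_mem_eq_inter, Finset.univ_inter]
      have z : ∑ v with v ∉ t, ∑ u, (if v ∈ t ∧ u ∈ t then f v u else 0) = 0 := by
        apply Finset.sum_eq_zero
        intro v hv
        apply Finset.sum_eq_zero
        intro u _
        simp only [Finset.mem_filter] at hv
        simp [hv.2]
      rw [z, add_zero]
      apply Finset.sum_congr rfl
      intro v hv
      simp [hv, Finset.sum_ite_mem]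
    rw [Finset.sum_congr rfl this, Finset.sum_comm]
    apply Finset.sum_congr rfl
    intro v _
    rw [Finset.sum_comm]
  have h4 : ∀ v u, (if goodAdj G γ v u then γ else 0) ≤
      ∑ t ∈ G.cliqueFinset 3, if v ∈ t ∧ u ∈ t then f v u else 0 := by
    intro v u
    by_cases g : goodAdj G γ v u
    · rw [if_pos g, ← Finset.sum_filter, Finset.sum_const, nsmul_eq_mul]
      have hsub : (G.neighborFinset v ∩ G.neighborFinset u).image
          (fun k => ({v, u, k} : Finset V)) ⊆
          (G.cliqueFinset 3).filter (fun t => v ∈ t ∧ u ∈ t) := by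
        intro t ht
        rw [Finset.mem_image] at ht
        obtain ⟨k, hk, rfl⟩ := ht
        simp only [Finset.mem_inter, SimpleGraph.mem_neighborFinset] at hk
        rw [Finset.mem_filter, SimpleGraph.mem_cliqueFinset_iff, SimpleGraph.is3Clique_triple_iff]
        exact ⟨⟨g.1, hk.1, hk.2⟩, by simp, by simp⟩
      have hc := Finset.card_le_card hsub
      rw [Finset.card_image_of_injOn (aux_tri_inj _ (by simp) (by simp))] at hc
      have hc' : ((G.neighborFinset v ∩ G.neighborFinset u).card : ℝ) ≤
        (((G.cliqueFinset 3).filter (fun t => v ∈ t ∧ u ∈ t)).card : ℝ) := by exact_mod_cast hc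
      have hd := (aux_good_deg hγ0 g).2
      have hfu : f v u = 1 / ((G.degree v : ℝ) - 1) := by simp only [f]; rw [if_pos g]
      rw [hfu, mul_one_div, le_div_iff₀ hd]
      have := (aux_good hγ0 g).2
      have := mul_le_mul_of_nonneg_left (aux_le_union G g.1) hγ0.le
      linarith
    · rw [if_neg g]
      apply Finset.sum_nonneg
      intro t _
      split_ifs
      · exact hf0 v u
      · exact le_rfl
  have h5 : ∑ v, ∑ u, (if goodAdj G γ v u then γ else 0) =
      2 * (γ * ((auxGood G γ).edgeFinset.card : ℝ)) := by
    have hd := (auxGood G γ).sum_degrees_eq_twice_card_edges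
    have : ∀ v, ∑ u, (if goodAdj G γ v u then γ else 0) = γ * ((auxGood G γ).degree v : ℝ) := by
      intro v
      rw [← Finset.sum_filter, Finset.sum_const, nsmul_eq_mul, mul_comm,
        ← SimpleGraph.card_neighborFinset_eq_degree, SimpleGraph.neighborFinset_eq_filter]
      congr 3
    rw [Finset.sum_congr rfl (fun v _ => this v), ← Finset.mul_sum]
    have hd' : (∑ v, ((auxGood G γ).degree v : ℝ)) = 2 * ((auxGood G γ).edgeFinset.card : ℝ) := by
      exact_mod_cast hd
    rw [hd']; ring
  have h6 := Finset.sum_le_sum fun v (_ : v ∈ (Finset.univ : Finset V)) =>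
    Finset.sum_le_sum fun u (_ : u ∈ (Finset.univ : Finset V)) => h4 v u
  rw [h5, ← h3] at h6
  linarith

end helpers

/-- Surviving triangle weight: after iteratively deleting edges of Jaccard similarity at
most `ε` from a `μ,γ`-triangle dense graph (`μ ≥ 1 − γ²/32`, `0 < ε ≤ γ³/12`), the
triangles of the final graph retain weight at least `γ·|E(G)|/4` (weights computed from
the original graph `G`). -/
theorem surviving_triangle_weight {V : Type*} [Fintype V] [DecidableEq V]
    (G : SimpleGraph V) (γ μ ε : ℝ) (hγ0 : 0 < γ) (hγ1 : γ ≤ 1)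
    (hμ : 1 - γ ^ 2 / 32 ≤ μ) (hε0 : 0 < ε) (hε1 : ε ≤ γ ^ 3 / 12)
    (hgood : μ * (ecount G : ℝ) ≤
      ((G.edgeFinset.filter (fun e => ∀ i j, e = s(i, j) → γ ≤ jac G i j)).card : ℝ))
    (m : ℕ) (Gs : ℕ → SimpleGraph V) (h0 : Gs 0 = G)
    (hstep : ∀ l < m, ∃ i j, (Gs l).Adj i j ∧ jac (Gs l) i j ≤ ε ∧
      Gs (l + 1) = (Gs l).deleteEdges {s(i, j)}) :
    γ * (ecount G : ℝ) / 4 ≤ ∑ t ∈ (Gs m).cliqueFinset 3, triWeight G γ t := by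
  let P : Sym2 V → Prop := fun e => ∀ i j, e = s(i, j) → γ ≤ jac G i j
  let c : Sym2 V → ℝ := fun e => if P e then γ / 4 else 4 / γ
  have hPij : ∀ i j, P s(i, j) ↔ γ ≤ jac G i j := by
    intro i j
    constructor
    · intro h; exact h i j rfl
    · intro h a b hab
      rcases Sym2.eq_iff.1 hab with ⟨rfl, rfl⟩ | ⟨rfl, rfl⟩
      · exact h
      · rw [aux_jac_symm]; exact h
  have hc0 : ∀ e, 0 ≤ c e := by
    intro e; simp only [c]; split_ifs <;> positivity
  have hind : ∀ l ≤ m, Gs l ≤ G ∧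
      auxW G γ G ≤ auxW G γ (Gs l) + ∑ e ∈ G.edgeFinset \ (Gs l).edgeFinset, c e := by
    intro l
    induction l with
    | zero => intro _; rw [h0]; simp
    | succ l ih =>
      intro hl
      obtain ⟨hle, hW⟩ := ih (by omega)
      obtain ⟨i, j, hadj, hjac, heq⟩ := hstep l (by omega)
      have hle' : Gs (l + 1) ≤ Gs l := by rw [heq]; exact SimpleGraph.deleteEdges_le _
      refine ⟨hle'.trans hle, ?_⟩
      have hs := aux_W_step G (Gs l) (Gs (l + 1)) hγ0 heq
      have hb : ∑ k ∈ (Gs l).neighborFinset i ∩ (Gs l).neighborFinset j,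
          triWeight G γ {i, j, k} ≤ c s(i, j) := by
        simp only [c]
        split_ifs with h
        · exact aux_good_step hγ0 hγ1 hε0 hε1 hle hadj hjac ⟨hle hadj, (hPij i j).1 h⟩
        · exact aux_bad_step hγ0 hγ1 hle hadj fun g => h ((hPij i j).2 g.2)
      have hsub : insert s(i, j) (G.edgeFinset \ (Gs l).edgeFinset) ⊆
          G.edgeFinset \ (Gs (l + 1)).edgeFinset := by
        intro e he
        rw [Finset.mem_insert] at he
        simp only [Finset.mem_sdiff, SimpleGraph.mem_edgeFinset] at he ⊢
        rcases he with rfl | ⟨h1, h2⟩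
        · refine ⟨hle hadj, ?_⟩
          rw [heq]; simp
        · exact ⟨h1, fun h => h2 (SimpleGraph.edgeSet_mono hle' h)⟩
      have hsum := Finset.sum_le_sum_of_subset_of_nonneg hsub (fun e _ _ => hc0 e)
      rw [Finset.sum_insert (by simp [hadj])] at hsum
      linarith
  have hfin := (hind m le_rfl).2
  have hlow := aux_lower G hγ0
  have hg : G.edgeFinset.filter P ⊆ (auxGood G γ).edgeFinset := by
    intro e he
    induction e with
    | h i j =>
      simp only [Finset.mem_filter, SimpleGraph.mem_edgeFinset, SimpleGraph.mem_edgeSet] at he ⊢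
      exact ⟨he.1, (hPij i j).1 he.2⟩
  have hgc : ((G.edgeFinset.filter P).card : ℝ) ≤ ((auxGood G γ).edgeFinset.card : ℝ) := by
    exact_mod_cast Finset.card_le_card hg
  have hgood' : μ * (ecount G : ℝ) ≤ ((G.edgeFinset.filter P).card : ℝ) := by
    convert hgood
  have hsumc : ∑ e ∈ G.edgeFinset \ (Gs m).edgeFinset, c e ≤ ∑ e ∈ G.edgeFinset, c e :=
    Finset.sum_le_sum_of_subset_of_nonneg Finset.sdiff_subset (fun e _ _ => hc0 e)
  have hsplit : ∑ e ∈ G.edgeFinset, c e = ((G.edgeFinset.filter P).card : ℝ) * (γ / 4) +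
      ((G.edgeFinset.filter (fun e => ¬ P e)).card : ℝ) * (4 / γ) := by
    simp only [c]
    rw [Finset.sum_ite, Finset.sum_const, Finset.sum_const, nsmul_eq_mul, nsmul_eq_mul]
  have hcard : ((G.edgeFinset.filter P).card : ℝ) +
      ((G.edgeFinset.filter (fun e => ¬ P e)).card : ℝ) = (ecount G : ℝ) := by
    unfold ecount
    exact_mod_cast Finset.card_filter_add_card_filter_not (s := G.edgeFinset) P
  change _ ≤ auxW G γ (Gs m)
  set E := (ecount G : ℝ) with hE
  set A := ((G.edgeFinset.filter P).card : ℝ) with hA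
  set B := ((G.edgeFinset.filter (fun e => ¬ P e)).card : ℝ) with hB
  have hE0 : 0 ≤ E := Nat.cast_nonneg _
  have hB0 : 0 ≤ B := Nat.cast_nonneg _
  have hA1 : (1 - γ ^ 2 / 32) * E ≤ A := (mul_le_mul_of_nonneg_right hμ hE0).trans hgood'
  have hB1 : B ≤ γ ^ 2 / 32 * E := by linarith
  have hB2 : B * (4 / γ) ≤ γ / 8 * E := by
    calc B * (4 / γ) ≤ (γ ^ 2 / 32 * E) * (4 / γ) := by gcongr
      _ = γ / 8 * E := by field_simp; ring
  have h7 : γ * A ≤ γ * ((auxGood G γ).edgeFinset.card : ℝ) := by gcongr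
  have h8 : (31 / 32) * E ≤ A := by
    have : γ ^ 2 ≤ 1 := by nlinarith
    nlinarith
  have h9 : γ * ((31 / 32) * E) ≤ γ * A := by gcongr
  have h10 : 0 ≤ γ * E := by positivity
  nlinarith
end

section
/- (Triangle weight bounded by edges) Let G be a finite simple graph and let H be a spanning subgraph of G in which every vertex incident to a triangle of H has degree at least 2 in G (this holds automatically since H is a subgraph of G). Then Σ_{{i,j,k} triangle of H} [1/(d_i(G) − 1) + 1/(d_j(G) − 1) + 1/(d_k(G) − 1)] ≤ |E(H)|, where d_v(G) denotes the degree of v in G. In particular, the left-hand side is at most the number of edges of H that lie in at least one triangle of H. -/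
open scoped Classical
open Finset

/-- The graph of edges lying in a triangle of `H`. -/
def triGraph {V : Type*} [Fintype V] [DecidableEq V] (H : SimpleGraph V) : SimpleGraph V where
  Adj u v := u ≠ v ∧ ∃ t ∈ H.cliqueFinset 3, u ∈ t ∧ v ∈ t
  symm := ⟨fun _ _ ⟨h, t, ht, a, b⟩ => ⟨h.symm, t, ht, b, a⟩⟩
  loopless := ⟨fun _ h => h.1 rfl⟩

lemma tri_codegree {V : Type*} [Fintype V] [DecidableEq V]
    (G H : SimpleGraph V) (hHG : H ≤ G) (u v : V) (huv : (triGraph H).Adj v u) :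
    ((H.cliqueFinset 3).filter (fun t => v ∈ t ∧ u ∈ t)).card ≤ G.degree v - 1 := by
  have hadj : ∀ t ∈ H.cliqueFinset 3, ∀ x ∈ t, ∀ y ∈ t, x ≠ y → G.Adj x y := by
    intro t ht x hx y hy hxy
    rw [SimpleGraph.mem_cliqueFinset_iff] at ht
    exact hHG (ht.1 hx hy hxy)
  obtain ⟨hne, t0, ht0, hv0, hu0⟩ := huv
  have h1 : u ∈ G.neighborFinset v := by
    rw [SimpleGraph.mem_neighborFinset]
    exact hadj t0 ht0 v hv0 u hu0 hne
  rw [← SimpleGraph.card_neighborFinset_eq_degree, ← Finset.card_erase_of_mem h1]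
  refine le_trans (Finset.card_le_card ?_)
    (Finset.card_image_le (s := (G.neighborFinset v).erase u)
      (f := fun w => ({v, u, w} : Finset V)))
  intro t ht
  rw [Finset.mem_filter] at ht
  obtain ⟨ht, hv, hu⟩ := ht
  have hc : t.card = 3 := ((SimpleGraph.mem_cliqueFinset_iff).1 ht).2
  have h2 : ((t.erase v).erase u).card = 1 := by
    rw [Finset.card_erase_of_mem (Finset.mem_erase.2 ⟨hne.symm, hu⟩),
      Finset.card_erase_of_mem hv, hc]
  obtain ⟨w, hw⟩ := Finset.card_eq_one.1 h2
  have hw' : w ∈ (t.erase v).erase u := by rw [hw]; simp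
  simp only [Finset.mem_erase] at hw'
  rw [Finset.mem_image]
  refine ⟨w, ?_, ?_⟩
  · rw [Finset.mem_erase, SimpleGraph.mem_neighborFinset]
    exact ⟨hw'.1, hadj t ht v hv w hw'.2.2 (Ne.symm hw'.2.1)⟩
  · rw [← Finset.insert_erase hv, ← Finset.insert_erase (Finset.mem_erase.2 ⟨hne.symm, hu⟩), hw]

lemma tri_vertex {V : Type*} [Fintype V] [DecidableEq V]
    (G H : SimpleGraph V) (hHG : H ≤ G) (v : V) :
    ((H.cliqueFinset 3).filter (fun t => v ∈ t)).card * 2 ≤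
      (triGraph H).degree v * (G.degree v - 1) := by
  have e1 : ((H.cliqueFinset 3).filter (fun t => v ∈ t)).card * 2 =
      ∑ t ∈ (H.cliqueFinset 3).filter (fun t => v ∈ t),
        (((triGraph H).neighborFinset v).filter (fun u => u ∈ t)).card := by
    rw [← smul_eq_mul, ← Finset.sum_const]
    refine Finset.sum_congr rfl fun t ht => ?_
    rw [Finset.mem_filter] at ht
    have hc : t.card = 3 := ((SimpleGraph.mem_cliqueFinset_iff).1 ht.1).2
    have : ((triGraph H).neighborFinset v).filter (fun u => u ∈ t) = t.erase v := by
      ext u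
      rw [Finset.mem_filter, SimpleGraph.mem_neighborFinset, Finset.mem_erase]
      exact ⟨fun h => ⟨h.1.1.symm, h.2⟩, fun h => ⟨⟨h.1.symm, t, ht.1, ht.2, h.2⟩, h.2⟩⟩
    rw [this, Finset.card_erase_of_mem ht.2, hc]
  have e2 := Finset.sum_card_bipartiteAbove_eq_sum_card_bipartiteBelow
    (s := (H.cliqueFinset 3).filter (fun t => v ∈ t)) (t := (triGraph H).neighborFinset v)
    (fun (t : Finset V) (u : V) => u ∈ t)
  unfold Finset.bipartiteAbove Finset.bipartiteBelow at e2
  rw [e1, e2, ← SimpleGraph.card_neighborFinset_eq_degree, ← smul_eq_mul]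
  refine Finset.sum_le_card_nsmul _ _ _ fun u hu => ?_
  rw [Finset.filter_filter]
  exact tri_codegree G H hHG u v ((SimpleGraph.mem_neighborFinset _ _ _).1 hu)

lemma tri_edges {V : Type*} [Fintype V] [DecidableEq V] (H : SimpleGraph V) :
    (triGraph H).edgeFinset =
      H.edgeFinset.filter (fun e => ∃ t ∈ H.cliqueFinset 3, ∀ v ∈ e, v ∈ t) := by
  ext e
  induction e using Sym2.ind with
  | _ x y =>
    rw [Finset.mem_filter, SimpleGraph.mem_edgeFinset, SimpleGraph.mem_edgeFinset,
      SimpleGraph.mem_edgeSet, SimpleGraph.mem_edgeSet]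
    constructor
    · rintro ⟨hne, t, ht, hx, hy⟩
      refine ⟨((SimpleGraph.mem_cliqueFinset_iff).1 ht).1 hx hy hne, t, ht, ?_⟩
      intro v hv
      rcases Sym2.mem_iff.1 hv with rfl | rfl <;> assumption
    · rintro ⟨ha, t, ht, h⟩
      exact ⟨ha.ne, t, ht, h x (Sym2.mem_mk_left x y), h y (Sym2.mem_mk_right x y)⟩

/-- Triangle weight bounded by edges: for a spanning subgraph `H ≤ G`, the sum over the
triangles of `H` of `1/(d_i(G)−1) + 1/(d_j(G)−1) + 1/(d_k(G)−1)` is at most `|E(H)|`;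
in particular it is at most the number of edges of `H` lying in a triangle of `H`. -/
theorem triangle_weight_le_edges {V : Type*} [Fintype V] [DecidableEq V]
    (G H : SimpleGraph V) (hHG : H ≤ G)
    (hdeg : ∀ v, (∃ t ∈ H.cliqueFinset 3, v ∈ t) → 2 ≤ G.degree v) :
    (∑ t ∈ H.cliqueFinset 3, ∑ v ∈ t, 1 / ((G.degree v : ℝ) - 1) ≤ (ecount H : ℝ)) ∧
    (∑ t ∈ H.cliqueFinset 3, ∑ v ∈ t, 1 / ((G.degree v : ℝ) - 1) ≤
      ((H.edgeFinset.filter (fun e => ∃ t ∈ H.cliqueFinset 3, ∀ v ∈ e, v ∈ t)).card : ℝ)) := by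
  have key : ∑ t ∈ H.cliqueFinset 3, ∑ v ∈ t, 1 / ((G.degree v : ℝ) - 1) ≤
      ((H.edgeFinset.filter (fun e => ∃ t ∈ H.cliqueFinset 3, ∀ v ∈ e, v ∈ t)).card : ℝ) := by
    rw [← tri_edges]
    have hs : ∑ t ∈ H.cliqueFinset 3, ∑ v ∈ t, 1 / ((G.degree v : ℝ) - 1) =
        ∑ v : V, ∑ t ∈ (H.cliqueFinset 3).filter (fun t => v ∈ t),
          1 / ((G.degree v : ℝ) - 1) := by
      refine Finset.sum_comm' fun t v => ?_
      simp
    have hd : ((∑ v : V, (triGraph H).degree v : ℕ) : ℝ) =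
        ((2 * (triGraph H).edgeFinset.card : ℕ) : ℝ) := by
      rw [SimpleGraph.sum_degrees_eq_twice_card_edges]
    push_cast at hd
    have hle : ∑ v : V, ∑ t ∈ (H.cliqueFinset 3).filter (fun t => v ∈ t),
          1 / ((G.degree v : ℝ) - 1) ≤ ∑ v : V, ((triGraph H).degree v : ℝ) / 2 := by
      refine Finset.sum_le_sum fun v _ => ?_
      rw [Finset.sum_const, nsmul_eq_mul]
      by_cases h : ∃ t ∈ H.cliqueFinset 3, v ∈ t
      · have h2 := hdeg v h
        have h3 := tri_vertex G H hHG v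
        have h4 : (((H.cliqueFinset 3).filter (fun t => v ∈ t)).card : ℝ) * 2 ≤
            (triGraph H).degree v * ((G.degree v : ℝ) - 1) := by
          have h5 := (Nat.cast_le (α := ℝ)).2 h3
          rw [Nat.cast_mul, Nat.cast_mul, Nat.cast_sub (by omega)] at h5
          exact_mod_cast h5
        have h6 : (0 : ℝ) < (G.degree v : ℝ) - 1 := by
          have : (2 : ℝ) ≤ G.degree v := by exact_mod_cast h2
          linarith
        rw [mul_one_div, div_le_div_iff₀ h6 two_pos]
        exact h4
      · have : (H.cliqueFinset 3).filter (fun t => v ∈ t) = ∅ :=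
          Finset.filter_eq_empty_iff.2 fun t ht hv => h ⟨t, ht, hv⟩
        rw [this, Finset.card_empty, Nat.cast_zero, zero_mul]
        positivity
    rw [← Finset.sum_div, hd] at hle
    rw [hs]
    linarith
  refine ⟨key.trans ?_, key⟩
  unfold ecount
  exact_mod_cast Finset.card_le_card (Finset.filter_subset _ _)
end
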